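/- (Geometric inverse Brascamp-Lieb inequality of Barthe-Wolff type.) Let H be a Euclidean space and Q a self-adjoint operator on H whose number of positive eigenvalues, counted with multiplicity, is s⁺(Q). Let U_i: H → E_i and V_j: H → E^j be linear maps with U_i U_i* = id_{E_i} and V_j V_j* = id_{E^j} for all 1≤i≤k, 1≤j≤m. Suppose Q + Σ_{i=1}^k c_i U_i* U_i = Σ_{j=1}^m d_j V_j* V_j + id_H and dim(H) ≥ s⁺(Q) + Σ_{i=1}^k dim(E_i). Then for all measurable functions f_i: E_i → [0,∞) (1≤i≤k) and g_j: E^j → [0,∞) (1≤j≤m), one has ∏_{i=1}^k (∫_{E_i} f_i)^{c_i} · ∏_{j=1}^m (∫_{E^j} g_j)^{−d_j} ≤ ∫_H e^{−π⟨Qx,x⟩} ∏_{i=1}^k f_i(U_i x)^{c_i} ∏_{j=1}^m g_j(V_j x)^{−d_j} dx, with the conventions 0^{−t} = +∞ for t > 0 and 0 · (+∞) = 0. -/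

import Mathlib

open MeasureTheory LinearMap
open scoped RealInnerProductSpace BigOperators NNReal ENNReal

noncomputable section

namespace FRBL

/-- A positive semidefinite (self-adjoint) operator on a real inner product space. -/
def PosSemidef {G : Type*} [NormedAddCommGroup G] [InnerProductSpace ℝ G]
    (A : G →ₗ[ℝ] G) : Prop :=
  A.IsSymmetric ∧ ∀ x : G, 0 ≤ ⟪A x, x⟫

/-- A positive definite (self-adjoint) operator on a real inner product space. -/
def PosDef {G : Type*} [NormedAddCommGroup G] [InnerProductSpace ℝ G]
    (A : G →ₗ[ℝ] G) : Prop :=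
  A.IsSymmetric ∧ ∀ x : G, x ≠ 0 → 0 < ⟪A x, x⟫

variable {k m : ℕ}
  (E : Fin k → Type*) (F : Fin m → Type*)
  [∀ i, NormedAddCommGroup (E i)] [∀ i, InnerProductSpace ℝ (E i)]
  [∀ i, FiniteDimensional ℝ (E i)]
  [∀ i, MeasurableSpace (E i)] [∀ i, BorelSpace (E i)]
  [∀ j, NormedAddCommGroup (F j)] [∀ j, InnerProductSpace ℝ (F j)]
  [∀ j, FiniteDimensional ℝ (F j)]
  [∀ j, MeasurableSpace (F j)] [∀ j, BorelSpace (F j)]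
  (c : Fin k → ℝ) (d : Fin m → ℝ)
  (B : ∀ i j, E i →ₗ[ℝ] F j)

/-- The pointwise domination hypothesis of the forward-reverse Brascamp-Lieb inequality. -/
def Hyp (f : ∀ i, E i → ℝ≥0) (g : ∀ j, F j → ℝ≥0) : Prop :=
  ∀ x : ∀ i, E i,
    (∏ i, f i (x i) ^ c i) ≤ ∏ j, g j (∑ i, c i • B i j (x i)) ^ d j

/-- `D₀` is an admissible constant for the forward-reverse Brascamp-Lieb inequality. -/
def IsBound (D₀ : ℝ) : Prop :=
  ∀ (f : ∀ i, E i → ℝ≥0) (g : ∀ j, F j → ℝ≥0),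
    (∀ i, Measurable (f i)) → (∀ j, Measurable (g j)) →
    Hyp E F c d B f g →
    (∏ i, (∫⁻ x, (f i x : ℝ≥0∞)) ^ c i) ≤
      ENNReal.ofReal (Real.exp D₀) * ∏ j, (∫⁻ y, (g j y : ℝ≥0∞)) ^ d j

/-- The best constant `D(c,d,B)` in the forward-reverse Brascamp-Lieb inequality. -/
def D : EReal :=
  sInf {x : EReal | ∃ D₀ : ℝ, x = (D₀ : EReal) ∧ IsBound E F c d B D₀}

/-- The gaussian constraint `Λ_c B* U_d B Λ_c ≤ V_c`, written via quadratic forms. -/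
def GaussCon (V : ∀ i, E i →ₗ[ℝ] E i) (U : ∀ j, F j →ₗ[ℝ] F j) : Prop :=
  ∀ x : ∀ i, E i,
    (∑ j, d j * ⟪U j (∑ i, c i • B i j (x i)), ∑ i, c i • B i j (x i)⟫) ≤
      ∑ i, c i * ⟪V i (x i), x i⟫

/-- The objective functional in the definition of the gaussian constant. -/
def gaussObj (V : ∀ i, E i →ₗ[ℝ] E i) (U : ∀ j, F j →ₗ[ℝ] F j) : ℝ :=
  (∑ j, d j * Real.log (LinearMap.det (U j)) -
    ∑ i, c i * Real.log (LinearMap.det (V i))) / 2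

/-- The gaussian best constant `D_g(c,d,B)`. -/
def Dg : EReal :=
  sSup {x : EReal | ∃ (V : ∀ i, E i →ₗ[ℝ] E i) (U : ∀ j, F j →ₗ[ℝ] F j),
    (∀ i, PosDef (V i)) ∧ (∀ j, PosDef (U j)) ∧ GaussCon E F c d B V U ∧
    x = (gaussObj E F c d V U : EReal)}

/-- The datum `(c,d,B)` is gaussian-extremizable: the supremum defining `D_g` is
finite and attained. -/
def GaussExt : Prop :=
  ∃ (V : ∀ i, E i →ₗ[ℝ] E i) (U : ∀ j, F j →ₗ[ℝ] F j),
    (∀ i, PosDef (V i)) ∧ (∀ j, PosDef (U j)) ∧ GaussCon E F c d B V U ∧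
    Dg E F c d B = (gaussObj E F c d V U : EReal)

/-- The canonical linear equivalence between `E₀ = ⊕ᵢ Eᵢ` (as `PiLp 2`) and the pi type. -/
def toPi : PiLp 2 E ≃ₗ[ℝ] ∀ i, E i := WithLp.linearEquiv 2 ℝ (∀ i, E i)

/-- Orthogonal projection `π_{E_i} : E₀ → E_i`. -/
def projL (i : Fin k) : PiLp 2 E →ₗ[ℝ] E i := (LinearMap.proj i).comp (toPi E).toLinearMap

/-- The embedding `E_i → E₀`. -/
def singleL (i : Fin k) : E i →ₗ[ℝ] PiLp 2 E :=
  (toPi E).symm.toLinearMap.comp (LinearMap.single ℝ E i)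

/-- The map `B_j : E₀ → E^j`, `x ↦ ∑ᵢ B_{ij} π_{E_i} x`. -/
def Bop (j : Fin m) : PiLp 2 E →ₗ[ℝ] F j := ∑ i, (B i j).comp (projL E i)

/-- `Λ_c = ⊕ᵢ cᵢ id_{E_i}` as an operator on `E₀`. -/
def Lam : PiLp 2 E →ₗ[ℝ] PiLp 2 E := ∑ i, c i • (singleL E i).comp (projL E i)

/-- The set `Π(A_1, …, A_k)` of positive semidefinite "couplings". -/
def Coupling (A : ∀ i, E i →ₗ[ℝ] E i) : Set (PiLp 2 E →ₗ[ℝ] PiLp 2 E) :=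
  {P | PosSemidef P ∧ ∀ (i : Fin k) (v : E i),
    ⟪P (singleL E i v), singleL E i v⟫ = ⟪A i v, v⟫}

/-- The scaling condition `∑ᵢ cᵢ dim Eᵢ = ∑ⱼ dⱼ dim E^j`. -/
def ScalingCond : Prop :=
  ∑ i, c i * (Module.finrank ℝ (E i) : ℝ) = ∑ j, d j * (Module.finrank ℝ (F j) : ℝ)

/-- A subspace `T ⊆ E₀` is of product form, i.e. `T = ⊕ᵢ π_{E_i} T`. -/
def ProductForm (T : Submodule ℝ (PiLp 2 E)) : Prop :=
  ∀ x ∈ T, ∀ i, singleL E i (projL E i x) ∈ T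

/-- The dimension condition over product-form subspaces. -/
def DimCond : Prop :=
  ∀ T : Submodule ℝ (PiLp 2 E), ProductForm E T →
    (∑ i, c i * (Module.finrank ℝ (T.map (projL E i)) : ℝ)) ≤
      ∑ j, d j * (Module.finrank ℝ (T.map (Bop E F B j)) : ℝ)

/-- A critical subspace. -/
def IsCritical (T : Submodule ℝ (PiLp 2 E)) : Prop :=
  T ≠ ⊥ ∧ T ≠ ⊤ ∧ ProductForm E T ∧
    ∑ i, c i * (Module.finrank ℝ (T.map (projL E i)) : ℝ) =
      ∑ j, d j * (Module.finrank ℝ (T.map (Bop E F B j)) : ℝ)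

/-- The datum is simple if it has no critical subspace. -/
def Simple : Prop := ∀ T : Submodule ℝ (PiLp 2 E), ¬ IsCritical E F c d B T

end FRBL

namespace FRBL

/-- `log det` with value `−∞` on operators with non-positive determinant
(in particular on singular positive-semidefinite operators). -/
def elogdet {G : Type*} [AddCommGroup G] [Module ℝ G] (A : G →ₗ[ℝ] G) : EReal :=
  if 0 < LinearMap.det A then ((Real.log (LinearMap.det A) : ℝ) : EReal) else ⊥

variable {k m : ℕ}
  (E : Fin k → Type*) (F : Fin m → Type*)
  [∀ i, NormedAddCommGroup (E i)] [∀ i, InnerProductSpace ℝ (E i)]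
  [∀ i, FiniteDimensional ℝ (E i)]
  [∀ j, NormedAddCommGroup (F j)] [∀ j, InnerProductSpace ℝ (F j)]
  [∀ j, FiniteDimensional ℝ (F j)]
  (c : Fin k → ℝ) (d : Fin m → ℝ)
  (B : ∀ i j, E i →ₗ[ℝ] F j)

/-- The map `Q_j := B_j Λ_c : E₀ → E^j`. -/
def BLam (j : Fin m) : PiLp 2 E →ₗ[ℝ] F j := (Bop E F B j).comp (Lam E c)

/-- The optimality condition of Theorem 2 (structure of gaussian extremizers):
each `B_j Λ_c Π Λ_c B_j*` is invertible and
`∑ⱼ dⱼ Λ_c B_j* (B_j Λ_c Π Λ_c B_j*)⁻¹ B_j Λ_c ≤ V_c` in the quadratic-form sense. -/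
def ExtCond (V : ∀ i, E i →ₗ[ℝ] E i) (P : PiLp 2 E →ₗ[ℝ] PiLp 2 E) : Prop :=
  (∀ j, IsUnit ((BLam E F c B j) ∘ₗ P ∘ₗ LinearMap.adjoint (BLam E F c B j))) ∧
  ∀ x : PiLp 2 E,
    (∑ j, d j * ⟪Ring.inverse ((BLam E F c B j) ∘ₗ P ∘ₗ LinearMap.adjoint (BLam E F c B j))
        (BLam E F c B j x), BLam E F c B j x⟫) ≤
      ∑ i, c i * ⟪V i (projL E i x), projL E i x⟫

/-- A geometric datum. -/
def Geometric : Prop :=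
  ScalingCond E F c d ∧
  ∃ S ∈ Coupling E (fun i => (LinearMap.id : E i →ₗ[ℝ] E i)),
    (∀ j, (BLam E F c B j) ∘ₗ S ∘ₗ LinearMap.adjoint (BLam E F c B j) = LinearMap.id) ∧
    ∀ x : PiLp 2 E, (∑ j, d j * ⟪BLam E F c B j x, BLam E F c B j x⟫) ≤ ⟪Lam E c x, x⟫

/-- Equivalence of data: `B'_j = C_j⁻¹ B_j C⁻¹` for invertible `C, C_j`. -/
def EquivData (B' : ∀ i j, E i →ₗ[ℝ] F j) : Prop :=
  ∃ (C : PiLp 2 E ≃ₗ[ℝ] PiLp 2 E) (Cj : ∀ j, F j ≃ₗ[ℝ] F j),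
    ∀ j, Bop E F B' j =
      ((Cj j).symm.toLinearMap ∘ₗ Bop E F B j) ∘ₗ C.symm.toLinearMap

/-- `V_c = ⊕ᵢ cᵢ Vᵢ` as an operator on `E₀`. -/
def blockDiag (V : ∀ i, E i →ₗ[ℝ] E i) : PiLp 2 E →ₗ[ℝ] PiLp 2 E :=
  ∑ i, c i • ((singleL E i) ∘ₗ (V i)) ∘ₗ (projL E i)

/-- `Θ = V_c − ∑ⱼ dⱼ Λ_c B_j* U_j B_j Λ_c`. -/
def Theta (V : ∀ i, E i →ₗ[ℝ] E i) (U : ∀ j, F j →ₗ[ℝ] F j) :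
    PiLp 2 E →ₗ[ℝ] PiLp 2 E :=
  blockDiag E c V -
    ∑ j, d j • (LinearMap.adjoint (BLam E F c B j) ∘ₗ (U j)) ∘ₗ (BLam E F c B j)

end FRBL

namespace FRBL

/-- Borel structure on submodules (inherited from the ambient space). -/
instance subBorel {G : Type*} [AddCommGroup G] [Module ℝ G] [TopologicalSpace G]
    [MeasurableSpace G] [BorelSpace G] (T : Submodule ℝ G) : BorelSpace ↥T :=
  Subtype.borelSpace (T : Set G)

/-- The maximal dimension of a subspace on which the self-adjoint operator `Q` is positive
definite; by Sylvester's law of inertia this is the number of positive eigenvalues of `Q`,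
counted with multiplicity. -/
def posIndex {H : Type*} [NormedAddCommGroup H] [InnerProductSpace ℝ H]
    (Q : H →ₗ[ℝ] H) : ℕ :=
  sSup {r : ℕ | ∃ W : Submodule ℝ H,
    (∀ x ∈ W, x ≠ 0 → 0 < ⟪Q x, x⟫) ∧ Module.finrank ℝ W = r}

/-- The standard gaussian probability measure on a Euclidean space. -/
def stdGaussian (G : Type*) [NormedAddCommGroup G] [InnerProductSpace ℝ G]
    [FiniteDimensional ℝ G] [MeasurableSpace G] [BorelSpace G] :
    Measure G :=
  volume.withDensity fun x =>
    ENNReal.ofReal ((2 * Real.pi) ^ (-(Module.finrank ℝ G : ℝ) / 2) *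
      Real.exp (-‖x‖ ^ 2 / 2))

/-- `K_s = (|s|^{1/s} |s'|^{1/s'})^{1/2}`. -/
def Kconst (s s' : ℝ) : ℝ := Real.sqrt (|s| ^ (1 / s) * |s'| ^ (1 / s'))

variable {k m : ℕ}
  (E : Fin k → Type*) (F : Fin m → Type*)
  [∀ i, NormedAddCommGroup (E i)] [∀ i, InnerProductSpace ℝ (E i)]
  [∀ i, FiniteDimensional ℝ (E i)]
  [∀ j, NormedAddCommGroup (F j)] [∀ j, InnerProductSpace ℝ (F j)]
  [∀ j, FiniteDimensional ℝ (F j)]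
  (c : Fin k → ℝ) (d : Fin m → ℝ)
  (B : ∀ i j, E i →ₗ[ℝ] F j)

/-- The objective functional `∑ⱼ dⱼ log det Uⱼ − ∑ᵢ cᵢ log det Vᵢ`. -/
def objective (V : ∀ i, E i →ₗ[ℝ] E i) (U : ∀ j, F j →ₗ[ℝ] F j) : ℝ :=
  ∑ j, d j * Real.log (LinearMap.det (U j)) - ∑ i, c i * Real.log (LinearMap.det (V i))

/-- Feasibility for the optimization problem defining `D_g`: positive definiteness
together with the constraint `Θ ≥ 0`. -/
def Admissible (V : ∀ i, E i →ₗ[ℝ] E i) (U : ∀ j, F j →ₗ[ℝ] F j) : Prop :=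
  (∀ i, PosDef (V i)) ∧ (∀ j, PosDef (U j)) ∧ PosSemidef (Theta E F c d B V U)

/-- Global maximality in the optimization problem defining `D_g`. -/
def IsGlobalMax (V : ∀ i, E i →ₗ[ℝ] E i) (U : ∀ j, F j →ₗ[ℝ] F j) : Prop :=
  Admissible E F c d B V U ∧
    ∀ V' U', Admissible E F c d B V' U' →
      objective E F c d V' U' ≤ objective E F c d V U

/-- Local maximality in the optimization problem defining `D_g`. -/
def IsLocalMax (V : ∀ i, E i →ₗ[ℝ] E i) (U : ∀ j, F j →ₗ[ℝ] F j) : Prop :=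
  Admissible E F c d B V U ∧
    ∃ ε : ℝ, 0 < ε ∧
      ∀ V' U', Admissible E F c d B V' U' →
        (∀ i, ‖LinearMap.toContinuousLinearMap (V' i - V i)‖ < ε) →
        (∀ j, ‖LinearMap.toContinuousLinearMap (U' j - U j)‖ < ε) →
        objective E F c d V' U' ≤ objective E F c d V U

end FRBL

namespace GaussianReverseHolder

open ProbabilityTheory Filter Topology

/-! ### Taylor estimates for logarithm and exponential -/

lemma one_add_add_sq_sub_abs_cube_le_exp (s : ℝ) : 1 + s + s ^ 2 / 2 - |s| ^ 3 ≤ Real.exp s := by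
  rcases le_total |s| 1 with h | h
  · have := (abs_le.1 (Real.exp_bound h (n := 3) (by norm_num))).1
    simp [Finset.sum_range_succ, Nat.factorial] at this
    have h3 : 0 ≤ |s| ^ 3 := by positivity
    linarith
  · rcases le_total 0 s with hs | hs
    · have := Real.quadratic_le_exp_of_nonneg hs
      have h3 : 0 ≤ |s| ^ 3 := by positivity
      linarith
    · rw [abs_of_nonpos hs] at h ⊢
      have := Real.exp_pos s
      nlinarith [mul_nonneg (sub_nonneg.2 h) (sq_nonneg s), sq_nonneg s]

lemma abs_log_sub_le {κ x : ℝ} (hκ : 0 < κ) (hx : κ ≤ x) :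
    |Real.log x - (x - 1)| ≤ (x - 1) ^ 2 / κ := by
  have hx0 : 0 < x := hκ.trans_le hx
  have h1 := Real.log_le_sub_one_of_pos hx0
  have h2 := Real.one_sub_inv_le_log_of_pos hx0
  rw [abs_of_nonpos (by linarith)]
  have h3 : (x - 1) ^ 2 / x ≤ (x - 1) ^ 2 / κ := by gcongr
  have h4 : (x - 1) ^ 2 / x = (x - 1) - (1 - x⁻¹) := by field_simp
  linarith

lemma abs_log_le {κ x : ℝ} (hκ : 0 < κ) (hκ1 : κ ≤ 1) (hx : κ ≤ x) :
    |Real.log x| ≤ |x - 1| / κ := by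
  have hx0 : 0 < x := hκ.trans_le hx
  have h1 := Real.log_le_sub_one_of_pos hx0
  have h2 := Real.one_sub_inv_le_log_of_pos hx0
  have h0 : |x - 1| ≤ |x - 1| / κ := le_div_self (abs_nonneg _) hκ hκ1
  have h3 : |x - 1| / x ≤ |x - 1| / κ := by gcongr
  have h4 : -(|x - 1| / x) ≤ (x - 1) / x := by
    rw [← neg_div]; gcongr; exact neg_abs_le _
  have h5 : (x - 1) / x = 1 - x⁻¹ := by field_simp
  rw [abs_le]
  constructor
  · linarith
  · linarith [le_abs_self (x - 1)]

lemma abs_log_sub_add_le {κ x : ℝ} (hκ : 0 < κ) (hκ1 : κ ≤ 1) (hx : κ ≤ x) :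
    |Real.log x - (x - 1) + (x - 1) ^ 2 / 2| ≤ |x - 1| ^ 3 / κ := by
  have hx0 : 0 < x := hκ.trans_le hx
  have key := (convex_uIcc (1 : ℝ) x).norm_image_sub_le_of_norm_hasDerivWithin_le
    (f := fun y => Real.log y - (y - 1) + (y - 1) ^ 2 / 2)
    (f' := fun y => y⁻¹ - 1 + (y - 1)) (C := |x - 1| ^ 2 / κ) (x := 1) (y := x)
    (by
      intro y hy
      have hy0 : 0 < y := by
        rcases Set.mem_uIcc.1 hy with h | h <;> linarith [h.1]
      have h1 := (Real.hasDerivAt_log hy0.ne').sub ((hasDerivAt_id y).sub_const 1)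
      have h2 := (((hasDerivAt_id y).sub_const 1).pow 2).div_const 2
      have := (h1.add h2).hasDerivWithinAt (s := Set.uIcc 1 x)
      convert this using 1
      · ext z
        simp
      · simp only [_root_.id]
        push_cast
        ring)
    (by
      intro y hy
      have hyκ : κ ≤ y := by
        rcases Set.mem_uIcc.1 hy with h | h <;> linarith [h.1]
      have hy0 : 0 < y := hκ.trans_le hyκ
      have : y⁻¹ - 1 + (y - 1) = (y - 1) ^ 2 / y := by field_simp; ring
      rw [this, Real.norm_eq_abs, abs_of_nonneg (by positivity), sq_abs]
      have h1 : |y - 1| ≤ |x - 1| := by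
        simpa using Set.abs_sub_left_of_mem_uIcc hy
      have h2 := sq_le_sq.2 h1
      gcongr)
    Set.left_mem_uIcc Set.right_mem_uIcc
  simp only [Real.norm_eq_abs, Real.log_one, sub_self] at key
  rw [show (0 : ℝ) + 0 ^ 2 / 2 = 0 by norm_num, sub_zero] at key
  refine key.trans (le_of_eq ?_)
  rw [div_mul_eq_mul_div, ← pow_succ]

lemma exists_prod_rpow_lower_bound {ι : Type*} [Fintype ι] (α : ι → ℝ) (K κ : ℝ)
    (hK : 0 ≤ K) (hκ : 0 < κ) (hκ1 : κ ≤ 1) :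
    ∃ C : ℝ, 0 ≤ C ∧ ∀ (e : ℝ) (D l : ι → ℝ), 0 ≤ e → (∀ a, |l a| ≤ K * e) →
      (∀ a, |D a| ≤ K * e) → (∀ a, |D a - l a| ≤ K * e ^ 2) → (∀ a, κ ≤ 1 + D a) →
      1 + ∑ a, α a * D a + ((∑ a, α a * l a) ^ 2 - ∑ a, α a * l a ^ 2) / 2 - C * e ^ 3 ≤
        ∏ a, (1 + D a) ^ α a := by
  set A : ℝ := ∑ a, |α a| with hA
  have hA0 : 0 ≤ A := Finset.sum_nonneg fun a _ => abs_nonneg _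
  have sumbd : ∀ (u : ι → ℝ) (B : ℝ), (∀ a, |u a| ≤ B) → |∑ a, α a * u a| ≤ A * B := by
    intro u B hu
    calc |∑ a, α a * u a| ≤ ∑ a, |α a * u a| := Finset.abs_sum_le_sum_abs _ _
      _ ≤ ∑ a, |α a| * B := by
        refine Finset.sum_le_sum fun a _ => ?_
        rw [abs_mul]
        exact mul_le_mul_of_nonneg_left (hu a) (abs_nonneg _)
      _ = A * B := by rw [hA, Finset.sum_mul]
  refine ⟨A * (K ^ 3 / κ) + A * (K ^ 2 / κ) * (A * (K / κ) + A * K) / 2 + A * K * (2 * (A * K)) / 2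
    + A * (2 * K ^ 2) / 2 + (A * (K / κ)) ^ 3, by positivity, ?_⟩
  intro e D l he hl hD hDl hκD
  have hpos : ∀ a, 0 < 1 + D a := fun a => hκ.trans_le (hκD a)
  set s : ℝ := ∑ a, α a * Real.log (1 + D a) with hs
  have hprod : ∏ a, (1 + D a) ^ α a = Real.exp s := by
    rw [hs, Real.exp_sum]
    refine Finset.prod_congr rfl fun a _ => ?_
    rw [Real.rpow_def_of_pos (hpos a), mul_comm]
  set T : ℝ := ∑ a, α a * D a with hT
  set Λ : ℝ := ∑ a, α a * l a with hΛ
  set P : ℝ := ∑ a, α a * D a ^ 2 with hP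
  set R : ℝ := ∑ a, α a * l a ^ 2 with hR
  have h1 : |s - T + P / 2| ≤ A * (K ^ 3 / κ * e ^ 3) := by
    have : s - T + P / 2 = ∑ a, α a * (Real.log (1 + D a) - D a + D a ^ 2 / 2) := by
      rw [hs, hT, hP, Finset.sum_div, ← Finset.sum_sub_distrib, ← Finset.sum_add_distrib]
      exact Finset.sum_congr rfl fun a _ => by ring
    rw [this]
    refine sumbd _ _ fun a => ?_
    have := abs_log_sub_add_le hκ hκ1 (hκD a)
    simp only [add_sub_cancel_left] at this
    refine this.trans ?_
    calc |D a| ^ 3 / κ ≤ (K * e) ^ 3 / κ := by gcongr; exact hD a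
      _ = _ := by ring
  have h2 : |s - T| ≤ A * (K ^ 2 / κ * e ^ 2) := by
    have : s - T = ∑ a, α a * (Real.log (1 + D a) - D a) := by
      rw [hs, hT, ← Finset.sum_sub_distrib]
      exact Finset.sum_congr rfl fun a _ => by ring
    rw [this]
    refine sumbd _ _ fun a => ?_
    have := abs_log_sub_le hκ (hκD a)
    simp only [add_sub_cancel_left] at this
    refine this.trans ?_
    calc D a ^ 2 / κ ≤ (K * e) ^ 2 / κ := by
          rw [← sq_abs (D a)]; gcongr; exact hD a
      _ = _ := by ring
  have h3 : |s| ≤ A * (K / κ * e) := by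
    refine sumbd _ _ fun a => ?_
    have := abs_log_le hκ hκ1 (hκD a)
    simp only [add_sub_cancel_left] at this
    refine this.trans ?_
    calc |D a| / κ ≤ (K * e) / κ := by gcongr; exact hD a
      _ = _ := by ring
  have h4 : |T| ≤ A * (K * e) := sumbd _ _ hD
  have h5 : |Λ| ≤ A * (K * e) := sumbd _ _ hl
  have h6 : |T - Λ| ≤ A * (K * e ^ 2) := by
    have : T - Λ = ∑ a, α a * (D a - l a) := by
      rw [hT, hΛ, ← Finset.sum_sub_distrib]
      exact Finset.sum_congr rfl fun a _ => by ring
    rw [this]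
    exact sumbd _ _ hDl
  have h7 : |P - R| ≤ A * (2 * K ^ 2 * e ^ 3) := by
    have : P - R = ∑ a, α a * (D a ^ 2 - l a ^ 2) := by
      rw [hP, hR, ← Finset.sum_sub_distrib]
      exact Finset.sum_congr rfl fun a _ => by ring
    rw [this]
    refine sumbd _ _ fun a => ?_
    have : D a ^ 2 - l a ^ 2 = (D a - l a) * (D a + l a) := by ring
    rw [this, abs_mul]
    calc |D a - l a| * |D a + l a| ≤ (K * e ^ 2) * (K * e + K * e) := by
          gcongr
          · exact hDl a
          · exact (abs_add_le _ _).trans (add_le_add (hD a) (hl a))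
      _ = _ := by ring
  have h8 : |s ^ 2 - T ^ 2| ≤ A * (K ^ 2 / κ) * (A * (K / κ) + A * K) * e ^ 3 := by
    have : s ^ 2 - T ^ 2 = (s - T) * (s + T) := by ring
    rw [this, abs_mul]
    calc |s - T| * |s + T| ≤ (A * (K ^ 2 / κ * e ^ 2)) * (A * (K / κ * e) + A * (K * e)) := by
          gcongr
          exact (abs_add_le _ _).trans (add_le_add h3 h4)
      _ = _ := by ring
  have h9 : |T ^ 2 - Λ ^ 2| ≤ A * K * (2 * (A * K)) * e ^ 3 := by
    have : T ^ 2 - Λ ^ 2 = (T - Λ) * (T + Λ) := by ring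
    rw [this, abs_mul]
    calc |T - Λ| * |T + Λ| ≤ (A * (K * e ^ 2)) * (A * (K * e) + A * (K * e)) := by
          gcongr
          exact (abs_add_le _ _).trans (add_le_add h4 h5)
      _ = _ := by ring
  have h10 : |s| ^ 3 ≤ (A * (K / κ)) ^ 3 * e ^ 3 := by
    calc |s| ^ 3 ≤ (A * (K / κ * e)) ^ 3 := by gcongr
      _ = _ := by ring
  rw [hprod]
  refine le_trans ?_ (one_add_add_sq_sub_abs_cube_le_exp s)
  have a1 := (abs_le.1 h1).1
  have a7 := (abs_le.1 h7).2
  have a8 := (abs_le.1 h8).1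
  have a9 := (abs_le.1 h9).1
  linarith

/-! ### Gaussian moments -/

section Moments

variable {H : Type*} [NormedAddCommGroup H] [InnerProductSpace ℝ H] [FiniteDimensional ℝ H]
  [MeasurableSpace H] [BorelSpace H]

lemma integrable_norm_pow_stdGaussian (n : ℕ) :
    Integrable (fun x : H => ‖x‖ ^ n) (stdGaussian H) :=
  (IsGaussian.memLp_id (stdGaussian H) n (by simp)).integrable_norm_pow'

lemma integrable_add_sq_pow_stdGaussian (M : ℝ) :
    Integrable (fun x : H => (M + ‖x‖ ^ 2) ^ 3) (stdGaussian H) := by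
  have : (fun x : H => (M + ‖x‖ ^ 2) ^ 3) =
      fun x => M ^ 3 + 3 * M ^ 2 * ‖x‖ ^ 2 + 3 * M * ‖x‖ ^ 4 + ‖x‖ ^ 6 := by
    ext x; ring
  rw [this]
  exact (((integrable_const _).add ((integrable_norm_pow_stdGaussian 2).const_mul _)).add
    ((integrable_norm_pow_stdGaussian 4).const_mul _)).add (integrable_norm_pow_stdGaussian 6)

lemma integrable_inner_stdGaussian (w : H) :
    Integrable (fun x : H => ⟪w, x⟫) (stdGaussian H) :=
  (innerSL ℝ w).integrable_comp IsGaussian.integrable_id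

lemma integral_inner_stdGaussian (w : H) : ∫ x, ⟪w, x⟫ ∂(stdGaussian H) = 0 :=
  integral_strongDual_stdGaussian (innerSL ℝ w)

lemma integrable_inner_sq_stdGaussian (w : H) :
    Integrable (fun x : H => ⟪w, x⟫ ^ 2) (stdGaussian H) := by
  refine ((integrable_norm_pow_stdGaussian (H := H) 2).const_mul (‖w‖ ^ 2)).mono'
    (by fun_prop) (ae_of_all _ fun x => ?_)
  rw [Real.norm_eq_abs, abs_pow, ← mul_pow]
  exact pow_le_pow_left₀ (abs_nonneg _) (abs_real_inner_le_norm w x) 2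

lemma integral_inner_sq_stdGaussian (w : H) :
    ∫ x, ⟪w, x⟫ ^ 2 ∂(stdGaussian H) = ‖w‖ ^ 2 := by
  have h := variance_dual_stdGaussian (innerSL ℝ w)
  have h2 := variance_of_integral_eq_zero (μ := stdGaussian H) (X := fun x => ⟪w, x⟫)
    (by fun_prop) (integral_inner_stdGaussian w)
  rw [innerSL_apply_norm] at h
  exact h2.symm.trans h

lemma eq_stdGaussian_of_charFun {μ : Measure H} [IsFiniteMeasure μ]
    (h : ∀ t, charFun μ t = Complex.exp (-‖t‖ ^ 2 / 2)) : μ = stdGaussian H :=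
  Measure.ext_of_charFun (by ext t; rw [h, charFun_stdGaussian])

/-- A coisometry maps the standard Gaussian to the standard Gaussian. -/
lemma map_stdGaussian_of_coisometry {G : Type*} [NormedAddCommGroup G] [InnerProductSpace ℝ G]
    [FiniteDimensional ℝ G] [MeasurableSpace G] [BorelSpace G] (M : H →ₗ[ℝ] G)
    (hM : M ∘ₗ LinearMap.adjoint M = LinearMap.id) :
    (stdGaussian H).map M = stdGaussian G := by
  have hmeas : Measurable M := M.continuous_of_finiteDimensional.measurable
  have : IsProbabilityMeasure ((stdGaussian H).map M) :=
    Measure.isProbabilityMeasure_map hmeas.aemeasurable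
  refine eq_stdGaussian_of_charFun fun t => ?_
  have h1 : ‖LinearMap.adjoint M t‖ ^ 2 = ‖t‖ ^ 2 := by
    rw [← real_inner_self_eq_norm_sq, LinearMap.adjoint_inner_left,
      ← LinearMap.comp_apply, hM, LinearMap.id_apply, real_inner_self_eq_norm_sq]
  have h2 : charFun ((stdGaussian H).map M) t = charFun (stdGaussian H) (LinearMap.adjoint M t) := by
    rw [charFun_apply, charFun_apply, integral_map hmeas.aemeasurable (by fun_prop)]
    simp_rw [LinearMap.adjoint_inner_right]
  rw [h2, charFun_stdGaussian, ← Complex.ofReal_pow, h1, Complex.ofReal_pow]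

/-- Stability of the Gaussian law: `sX + tY` has the law of `√(s² + t²) Z`. -/
lemma map_add_smul_stdGaussian (s t r : ℝ) (h : s ^ 2 + t ^ 2 = r ^ 2) :
    ((stdGaussian H).prod (stdGaussian H)).map (fun z => s • z.1 + t • z.2) =
      (stdGaussian H).map (fun x => r • x) := by
  have i1 := Measure.isProbabilityMeasure_map (μ := (stdGaussian H).prod (stdGaussian H))
    (f := fun z => s • z.1 + t • z.2) (by fun_prop)
  have i2 := Measure.isProbabilityMeasure_map (μ := stdGaussian H)
    (f := fun x => r • x) (by fun_prop)
  refine Measure.ext_of_charFun ?_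
  ext u
  have key : ∀ c : ℝ, ∀ v : H, charFun (stdGaussian H) (c • v) =
      Complex.exp (-(c ^ 2 * ‖v‖ ^ 2 : ℝ) / 2) := by
    intro c v
    rw [charFun_stdGaussian, norm_smul, Real.norm_eq_abs]
    congr 2
    push_cast
    rw [mul_pow, ← Complex.ofReal_pow, sq_abs, Complex.ofReal_pow]
  have e2 : charFun ((stdGaussian H).map (fun x => r • x)) u = charFun (stdGaussian H) (r • u) :=
    charFun_map_smul r u
  have e1 : charFun (((stdGaussian H).prod (stdGaussian H)).map (fun z => s • z.1 + t • z.2)) u =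
      charFun (stdGaussian H) (s • u) * charFun (stdGaussian H) (t • u) := by
    simp only [charFun_apply]
    rw [integral_map (by fun_prop) (by fun_prop), ← integral_prod_mul]
    refine integral_congr_ae (ae_of_all _ fun z => ?_)
    simp only [inner_add_left, inner_smul_left, inner_smul_right]
    rw [← Complex.exp_add]
    congr 1
    push_cast
    simp
    ring
  rw [e1, e2, key, key, key, ← Complex.exp_add, ← h]
  congr 1
  push_cast
  ring

end Moments

/-! ### Functions with bounded gradient in a fixed subspace, and Gaussian averages -/

lemma continuous_of_forall_norm_sub_le {H G : Type*} [NormedAddCommGroup H]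
    [NormedAddCommGroup G] {L : ℝ} {p : H → G}
    (h : ∀ x y, ‖p x - p y‖ ≤ L * ‖x - y‖) : Continuous p := by
  refine (LipschitzWith.of_dist_le_mul (K := L.toNNReal) fun x y => ?_).continuous
  rw [dist_eq_norm, dist_eq_norm]
  refine (h x y).trans ?_
  gcongr
  exact Real.le_coe_toNNReal L

section Averages

variable {H : Type*} [NormedAddCommGroup H] [InnerProductSpace ℝ H] [FiniteDimensional ℝ H]
  [MeasurableSpace H] [BorelSpace H]

/-- `h` takes values in `[δ, N]`, is `L`-Lipschitz, and has an `L`-Lipschitz gradient with values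
in the subspace `K`. -/
structure HasTameGradient (K : Submodule ℝ H) (δ N L : ℝ) (h : H → ℝ) : Prop where
  lower : ∀ x, δ ≤ h x
  upper : ∀ x, h x ≤ N
  lipschitz : ∀ x y, |h x - h y| ≤ L * ‖x - y‖
  exists_gradient : ∃ p : H → H, (∀ x, p x ∈ K) ∧ (∀ x, ‖p x‖ ≤ L) ∧
    (∀ x y, ‖p x - p y‖ ≤ L * ‖x - y‖) ∧ ∀ x v, |h (x + v) - h x - ⟪p x, v⟫| ≤ L * ‖v‖ ^ 2

/-- The Gaussian average of `h` at scale `ε`. -/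
def gaussAvg (ε : ℝ) (h : H → ℝ) (y : H) : ℝ := ∫ x, h (y + ε • x) ∂(stdGaussian H)

lemma HasTameGradient.continuous {K : Submodule ℝ H} {δ N L : ℝ} {h : H → ℝ}
    (hh : HasTameGradient K δ N L h) : Continuous h :=
  continuous_of_forall_norm_sub_le hh.lipschitz

lemma integrable_of_continuous_of_bound {G : Type*} [NormedAddCommGroup G] [NormedSpace ℝ G]
    [FiniteDimensional ℝ G]
    {B : ℝ} {p : H → G} (hp : Continuous p) (hB : ∀ x, ‖p x‖ ≤ B) (y : H) (ε : ℝ) :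
    Integrable (fun x => p (y + ε • x)) (stdGaussian H) := by
  borelize G
  exact Integrable.of_bound (C := B) (Continuous.aestronglyMeasurable (by fun_prop))
    (ae_of_all _ fun x => hB _)

lemma HasTameGradient.integrable {K : Submodule ℝ H} {δ N L : ℝ} {h : H → ℝ}
    (hh : HasTameGradient K δ N L h) (y : H) (ε : ℝ) :
    Integrable (fun x => h (y + ε • x)) (stdGaussian H) :=
  integrable_of_continuous_of_bound hh.continuous
    (fun x => abs_le_max_abs_abs (hh.lower x) (hh.upper x)) y ε

lemma HasTameGradient.average {K : Submodule ℝ H} {δ N L : ℝ} {h : H → ℝ}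
    (hh : HasTameGradient K δ N L h) (ε : ℝ) :
    HasTameGradient K δ N L (gaussAvg ε h) := by
  have avg_le : ∀ {u : H → ℝ} {B : ℝ}, (∀ x, ‖u x‖ ≤ B) → |∫ x, u x ∂(stdGaussian H)| ≤ B := by
    intro u B hu
    simpa using norm_integral_le_of_norm_le_const (μ := stdGaussian H) (ae_of_all _ hu)
  refine ⟨fun y => ?_, fun y => ?_, fun y z => ?_, ?_⟩
  · have := integral_mono (integrable_const δ) (hh.integrable y ε) fun x => hh.lower (y + ε • x)
    simpa [gaussAvg] using this
  · have := integral_mono (hh.integrable y ε) (integrable_const N) fun x => hh.upper (y + ε • x)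
    simpa [gaussAvg] using this
  · rw [gaussAvg, gaussAvg,
      ← integral_sub (hh.integrable y ε) (hh.integrable z ε)]
    refine avg_le fun x => ?_
    simpa using hh.lipschitz (y + ε • x) (z + ε • x)
  · obtain ⟨p, hpK, hpL, hpLip, hp⟩ := hh.exists_gradient
    have hpc := continuous_of_forall_norm_sub_le hpLip
    have hpi := integrable_of_continuous_of_bound hpc hpL
    refine ⟨fun y => ∫ x, p (y + ε • x) ∂(stdGaussian H), fun y => ?_, fun y => ?_,
      fun y z => ?_, fun y v => ?_⟩
    · exact K.convex.integral_mem K.closed_of_finiteDimensional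
        (ae_of_all _ fun x => hpK _) (hpi y ε)
    · simpa using norm_integral_le_of_norm_le_const (μ := stdGaussian H)
        (ae_of_all _ fun x => hpL (y + ε • x))
    · rw [← integral_sub (hpi y ε) (hpi z ε)]
      have := norm_integral_le_of_norm_le_const (μ := stdGaussian H)
        (f := fun x => p (y + ε • x) - p (z + ε • x)) (C := L * ‖y - z‖)
        (ae_of_all _ fun x => by simpa using hpLip (y + ε • x) (z + ε • x))
      simpa using this
    · have e1 : ⟪∫ x, p (y + ε • x) ∂(stdGaussian H), v⟫ =
          ∫ x, ⟪p (y + ε • x), v⟫ ∂(stdGaussian H) := by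
        rw [real_inner_comm, ← integral_inner (hpi y ε) v]
        simp_rw [real_inner_comm v]
      have i1 : Integrable (fun x => ⟪p (y + ε • x), v⟫) (stdGaussian H) := by
        simp_rw [real_inner_comm v]
        exact (hpi y ε).const_inner v
      simp only [gaussAvg]
      have i2 : Integrable (fun x => h (y + v + ε • x) - h (y + ε • x)) (stdGaussian H) :=
        (hh.integrable _ ε).sub (hh.integrable y ε)
      rw [e1, ← integral_sub (hh.integrable _ ε) (hh.integrable y ε), ← integral_sub i2 i1]
      refine avg_le fun x => ?_
      have := hp (y + ε • x) v
      rwa [add_right_comm] at this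

lemma HasTameGradient.continuous_prod_rpow {ι : Type*} [Fintype ι] {K : ι → Submodule ℝ H}
    {δ N L : ℝ} (hδ : 0 < δ) (α : ι → ℝ) {h : ι → H → ℝ}
    (hh : ∀ a, HasTameGradient (K a) δ N L (h a)) :
    Continuous fun x => ∏ a, h a x ^ α a :=
  continuous_finsetProd _ fun a _ => (hh a).continuous.rpow_const fun x =>
    Or.inl (hδ.trans_le ((hh a).lower x)).ne'

lemma rpow_le_max_rpow {δ N t : ℝ} (hδ : 0 < δ) (h1 : δ ≤ t) (h2 : t ≤ N) (r : ℝ) :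
    t ^ r ≤ max (δ ^ r) (N ^ r) := by
  rcases le_total 0 r with h | h
  · exact le_max_of_le_right (Real.rpow_le_rpow (hδ.le.trans h1) h2 h)
  · exact le_max_of_le_left (Real.rpow_le_rpow_of_nonpos hδ h1 h)

lemma abs_prod_rpow_le {ι : Type*} [Fintype ι] {δ N : ℝ} (hδ : 0 < δ) (α t : ι → ℝ)
    (h1 : ∀ a, δ ≤ t a) (h2 : ∀ a, t a ≤ N) :
    |∏ a, t a ^ α a| ≤ ∏ a, max (δ ^ α a) (N ^ α a) := by
  have h0 : ∀ a, 0 ≤ t a ^ α a := fun a => Real.rpow_nonneg (hδ.le.trans (h1 a)) _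
  rw [abs_of_nonneg (Finset.prod_nonneg fun a _ => h0 a)]
  exact Finset.prod_le_prod (fun a _ => h0 a) fun a _ => rpow_le_max_rpow hδ (h1 a) (h2 a) _

lemma HasTameGradient.integrable_prod_rpow {ι : Type*} [Fintype ι] {K : ι → Submodule ℝ H}
    {δ N L : ℝ} (hδ : 0 < δ) (α : ι → ℝ) {h : ι → H → ℝ}
    (hh : ∀ a, HasTameGradient (K a) δ N L (h a)) (y : H) (ε : ℝ) :
    Integrable (fun x => ∏ a, h a (y + ε • x) ^ α a) (stdGaussian H) :=
  integrable_of_continuous_of_bound (p := fun x => ∏ a, h a x ^ α a)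
    (HasTameGradient.continuous_prod_rpow hδ α hh)
    (fun x => abs_prod_rpow_le hδ α _ (fun a => (hh a).lower x) fun a => (hh a).upper x) y ε

lemma HasTameGradient.exists_expansion {K : Submodule ℝ H} {δ N L : ℝ} {h : H → ℝ}
    (hh : HasTameGradient K δ N L h) {ε : ℝ} (hε : 0 ≤ ε) (y : H) :
    ∃ q ∈ K, ‖q‖ ≤ L ∧ ∀ x,
      |h (y + ε • x) - gaussAvg ε h y| ≤ L * ε * (‖x‖ + ∫ z, ‖z‖ ∂(stdGaussian H)) ∧
      |h (y + ε • x) - gaussAvg ε h y - ε * ⟪q, x⟫| ≤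
        L * ε ^ 2 * (‖x‖ ^ 2 + ∫ z, ‖z‖ ^ 2 ∂(stdGaussian H)) := by
  obtain ⟨p, hpK, hpL, -, hp⟩ := hh.exists_gradient
  have n1 : Integrable (fun z : H => ‖z‖) (stdGaussian H) := by
    simpa using integrable_norm_pow_stdGaussian (H := H) 1
  have n2 : Integrable (fun z : H => ‖z‖ ^ 2) (stdGaussian H) :=
    integrable_norm_pow_stdGaussian 2
  have b1 : ∀ x, |h (y + ε • x) - h y| ≤ L * ε * ‖x‖ := fun x => by
    have := hh.lipschitz (y + ε • x) y
    rwa [add_sub_cancel_left, norm_smul, Real.norm_of_nonneg hε, ← mul_assoc] at this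
  have b2 : ∀ x, |h (y + ε • x) - h y - ε * ⟪p y, x⟫| ≤ L * ε ^ 2 * ‖x‖ ^ 2 := fun x => by
    have := hp y (ε • x)
    rwa [inner_smul_right, norm_smul, Real.norm_of_nonneg hε, mul_pow, ← mul_assoc] at this
  have i1 : Integrable (fun x => h (y + ε • x) - h y) (stdGaussian H) :=
    (hh.integrable y ε).sub (integrable_const _)
  have i2 : Integrable (fun x => ε * ⟪p y, x⟫) (stdGaussian H) :=
    (integrable_inner_stdGaussian (p y)).const_mul ε
  have e1 : ∫ x, (h (y + ε • x) - h y) ∂(stdGaussian H) = gaussAvg ε h y - h y := by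
    rw [integral_sub (hh.integrable y ε) (integrable_const _)]
    simp [gaussAvg]
  have e2 : ∫ x, (h (y + ε • x) - h y - ε * ⟪p y, x⟫) ∂(stdGaussian H) =
      gaussAvg ε h y - h y := by
    rw [integral_sub i1 i2, e1, integral_const_mul, integral_inner_stdGaussian]
    ring
  have m1 : |gaussAvg ε h y - h y| ≤ L * ε * ∫ z, ‖z‖ ∂(stdGaussian H) := by
    rw [← e1, ← integral_const_mul]
    exact norm_integral_le_of_norm_le (f := fun x => h (y + ε • x) - h y) (n1.const_mul _)
      (ae_of_all _ b1)
  have m2 : |gaussAvg ε h y - h y| ≤ L * ε ^ 2 * ∫ z, ‖z‖ ^ 2 ∂(stdGaussian H) := by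
    rw [← e2, ← integral_const_mul]
    exact norm_integral_le_of_norm_le (f := fun x => h (y + ε • x) - h y - ε * ⟪p y, x⟫)
      (n2.const_mul _) (ae_of_all _ b2)
  refine ⟨p y, hpK y, hpL y, fun x => ⟨?_, ?_⟩⟩
  · have t := abs_sub (h (y + ε • x) - h y) (gaussAvg ε h y - h y)
    rw [sub_sub_sub_cancel_right] at t
    linarith [b1 x]
  · have t := abs_sub (h (y + ε • x) - h y - ε * ⟪p y, x⟫) (gaussAvg ε h y - h y)
    rw [show h (y + ε • x) - h y - ε * ⟪p y, x⟫ - (gaussAvg ε h y - h y) =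
      h (y + ε • x) - gaussAvg ε h y - ε * ⟪p y, x⟫ by ring] at t
    linarith [b2 x]

/-- One step of the Gaussian reverse Hölder inequality, with a third-order error. -/
lemma exists_prod_gaussAvg_rpow_le {ι : Type*} [Fintype ι] (K : ι → Submodule ℝ H) (α : ι → ℝ)
    (hα : ∀ w : ι → H, (∀ a, w a ∈ K a) → ∑ a, α a * ‖w a‖ ^ 2 ≤ ‖∑ a, α a • w a‖ ^ 2)
    {δ N L : ℝ} (hδ : 0 < δ) (hδN : δ ≤ N) (hL : 0 ≤ L) :
    ∃ C : ℝ, 0 ≤ C ∧ ∀ ε : ℝ, 0 ≤ ε → ∀ h : ι → H → ℝ,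
      (∀ a, HasTameGradient (K a) δ N L (h a)) → ∀ y,
      (1 - C * ε ^ 3) * ∏ a, gaussAvg ε (h a) y ^ α a ≤
        gaussAvg ε (fun x => ∏ a, h a x ^ α a) y := by
  have hN : 0 < N := hδ.trans_le hδN
  obtain ⟨C, hC, hexp⟩ := exists_prod_rpow_lower_bound α (L / δ) (δ / N) (by positivity)
    (by positivity) ((div_le_one hN).2 hδN)
  set M1 : ℝ := ∫ z, ‖z‖ ∂(stdGaussian H) with hM1
  set M2 : ℝ := ∫ z, ‖z‖ ^ 2 ∂(stdGaussian H) with hM2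
  have hM1' : 0 ≤ M1 := integral_nonneg fun z => norm_nonneg _
  have hM2' : 0 ≤ M2 := integral_nonneg fun z => sq_nonneg _
  set M : ℝ := 1 + M1 + M2 with hM
  set W : H → ℝ := fun x => M + ‖x‖ ^ 2 with hW
  have hW1 : ∀ x, 1 ≤ W x := fun x => by simp only [hW, hM]; nlinarith [sq_nonneg ‖x‖]
  have hWi : Integrable (fun x => W x ^ 3) (stdGaussian H) := integrable_add_sq_pow_stdGaussian M
  refine ⟨C * ∫ x, W x ^ 3 ∂(stdGaussian H), mul_nonneg hC
    (integral_nonneg fun x => pow_nonneg (zero_le_one.trans (hW1 x)) 3), ?_⟩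
  intro ε hε h hh y
  choose q hqK hqL hq using fun a => (hh a).exists_expansion hε y
  set m : ι → ℝ := fun a => gaussAvg ε (h a) y with hm
  have hmδ : ∀ a, δ ≤ m a := fun a => ((hh a).average ε).lower y
  have hmN : ∀ a, m a ≤ N := fun a => ((hh a).average ε).upper y
  have hm0 : ∀ a, 0 < m a := fun a => hδ.trans_le (hmδ a)
  set D : ι → H → ℝ := fun a x => (h a (y + ε • x) - m a) / m a with hD
  set w : ι → H := fun a => (m a)⁻¹ • q a with hw
  have hDm : ∀ a x, h a (y + ε • x) = m a * (1 + D a x) := fun a x => by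
    have := (hm0 a).ne'
    simp only [hD]; field_simp; ring
  have hpt : ∀ x, 1 + ∑ a, α a * D a x +
      ((∑ a, α a * (ε * ⟪w a, x⟫)) ^ 2 - ∑ a, α a * (ε * ⟪w a, x⟫) ^ 2) / 2 -
        C * (ε * W x) ^ 3 ≤ ∏ a, (1 + D a x) ^ α a := by
    intro x
    have hx0 := norm_nonneg x
    have hWx : ‖x‖ + M1 ≤ W x := by simp only [hW, hM]; nlinarith [sq_nonneg (‖x‖ - 1)]
    have hWx2 : ‖x‖ ^ 2 + M2 ≤ W x ^ 2 := by
      have : ‖x‖ ^ 2 + M2 ≤ W x := by simp only [hW, hM]; linarith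
      nlinarith [hW1 x]
    refine hexp (ε * W x) (fun a => D a x) (fun a => ε * ⟪w a, x⟫)
      (mul_nonneg hε (zero_le_one.trans (hW1 x))) (fun a => ?_) (fun a => ?_) (fun a => ?_)
      (fun a => ?_)
    · have h1 : |⟪q a, x⟫| ≤ L * W x := (abs_real_inner_le_norm _ _).trans
        (mul_le_mul (hqL a) (by linarith) hx0 hL)
      simp only [hw, inner_smul_left, map_inv₀, conj_trivial]
      rw [abs_mul, abs_mul, abs_of_nonneg hε, abs_of_pos (inv_pos.2 (hm0 a))]
      calc ε * ((m a)⁻¹ * |⟪q a, x⟫|) ≤ ε * (δ⁻¹ * (L * W x)) := by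
            gcongr
            exact hmδ a
        _ = _ := by ring
    · simp only [hD]
      rw [abs_div, abs_of_pos (hm0 a)]
      calc |h a (y + ε • x) - m a| / m a ≤ (L * ε * (‖x‖ + M1)) / δ := by
            gcongr
            · exact (hq a x).1
            · exact hmδ a
        _ ≤ (L * ε * W x) / δ := by gcongr
        _ = _ := by ring
    · have : D a x - ε * ⟪w a, x⟫ = (h a (y + ε • x) - m a - ε * ⟪q a, x⟫) / m a := by
        simp only [hD, hw, inner_smul_left, map_inv₀, conj_trivial]
        ring
      rw [this, abs_div, abs_of_pos (hm0 a)]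
      calc |h a (y + ε • x) - m a - ε * ⟪q a, x⟫| / m a
          ≤ (L * ε ^ 2 * (‖x‖ ^ 2 + M2)) / δ := by
            gcongr
            · exact (hq a x).2
            · exact hmδ a
        _ ≤ (L * ε ^ 2 * W x ^ 2) / δ := by gcongr
        _ = _ := by ring
    · have : 1 + D a x = h a (y + ε • x) / m a := by
        rw [hDm]; field_simp [(hm0 a).ne']
      rw [this]
      exact div_le_div₀ (hδ.le.trans ((hh a).lower _)) ((hh a).lower _) (hm0 a) (hmN a)
  have hint : Integrable (fun x => ∏ a, (1 + D a x) ^ α a) (stdGaussian H) := by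
    have : (fun x => ∏ a, (1 + D a x) ^ α a) =
        fun x => (∏ a, h a (y + ε • x) ^ α a) / ∏ a, m a ^ α a := by
      ext x
      rw [← Finset.prod_div_distrib]
      refine Finset.prod_congr rfl fun a _ => ?_
      rw [← Real.div_rpow (hδ.le.trans ((hh a).lower _)) (hm0 a).le, hDm,
        mul_div_cancel_left₀ _ (hm0 a).ne']
    rw [this]
    exact (HasTameGradient.integrable_prod_rpow hδ α hh y ε).div_const _
  have hprod : gaussAvg ε (fun x => ∏ a, h a x ^ α a) y =
      (∫ x, ∏ a, (1 + D a x) ^ α a ∂(stdGaussian H)) * ∏ a, m a ^ α a := by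
    rw [gaussAvg, ← integral_mul_const]
    congr 1
    ext x
    rw [← Finset.prod_mul_distrib]
    refine Finset.prod_congr rfl fun a _ => ?_
    have h1 : 0 ≤ 1 + D a x := by
      have := hDm a x
      have h2 := hδ.trans_le ((hh a).lower (y + ε • x))
      rw [this] at h2
      exact (pos_of_mul_pos_right h2 (hm0 a).le).le
    rw [hDm, Real.mul_rpow (hm0 a).le h1, mul_comm]
  rw [hprod]
  refine mul_le_mul_of_nonneg_right ?_
    (Finset.prod_nonneg fun a _ => Real.rpow_nonneg (hm0 a).le _)
  have iD : ∀ a, Integrable (fun x => D a x) (stdGaussian H) := fun a =>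
    (((hh a).integrable y ε).sub (integrable_const _)).div_const _
  have zD : ∀ a, ∫ x, D a x ∂(stdGaussian H) = 0 := fun a => by
    simp only [hD]
    rw [integral_div, integral_sub ((hh a).integrable y ε) (integrable_const _)]
    simp [hm, gaussAvg]
  have hquad : ∀ x : H, (∑ a, α a * (ε * ⟪w a, x⟫)) ^ 2 - ∑ a, α a * (ε * ⟪w a, x⟫) ^ 2 =
      ε ^ 2 * (⟪∑ a, α a • w a, x⟫ ^ 2 - ∑ a, α a * ⟪w a, x⟫ ^ 2) := by
    intro x
    rw [sum_inner, mul_sub, ← mul_pow, Finset.mul_sum, Finset.mul_sum]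
    congr 1
    · congr 1
      exact Finset.sum_congr rfl fun a _ => by rw [real_inner_smul_left (w a) x (α a)]; ring
    · exact Finset.sum_congr rfl fun a _ => by ring
  simp_rw [hquad] at hpt
  have j1 : Integrable (fun x => 1 + ∑ a, α a * D a x) (stdGaussian H) :=
    (integrable_const _).add (integrable_finsetSum _ fun a _ => (iD a).const_mul _)
  have j3 : Integrable (fun x => ∑ a, α a * ⟪w a, x⟫ ^ 2) (stdGaussian H) :=
    integrable_finsetSum _ fun a _ => (integrable_inner_sq_stdGaussian _).const_mul _
  have j4 : Integrable (fun x => ⟪∑ a, α a • w a, x⟫ ^ 2 - ∑ a, α a * ⟪w a, x⟫ ^ 2)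
      (stdGaussian H) := (integrable_inner_sq_stdGaussian _).sub j3
  have j5 : Integrable (fun x =>
      ε ^ 2 * (⟪∑ a, α a • w a, x⟫ ^ 2 - ∑ a, α a * ⟪w a, x⟫ ^ 2) / 2) (stdGaussian H) :=
    (j4.const_mul _).div_const _
  have j6 : Integrable (fun x => C * (ε * W x) ^ 3) (stdGaussian H) := by
    simp_rw [mul_pow]
    exact (hWi.const_mul _).const_mul _
  refine le_trans ?_ (integral_mono ((j1.add j5).sub j6) hint hpt)
  have k6 : ∫ x, C * (ε * W x) ^ 3 ∂(stdGaussian H) =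
      C * ε ^ 3 * ∫ x, W x ^ 3 ∂(stdGaussian H) := by
    rw [← integral_const_mul]
    congr 1; ext x; ring
  have k1 : ∫ x, (1 + ∑ a, α a * D a x) ∂(stdGaussian H) = 1 + 0 := by
    rw [integral_add (integrable_const _)
      (integrable_finsetSum _ fun a _ => (iD a).const_mul _),
      integral_finsetSum _ fun a _ => (iD a).const_mul _]
    simp [integral_const_mul, zD]
  have k4 : 0 ≤ ∫ x, (⟪∑ a, α a • w a, x⟫ ^ 2 - ∑ a, α a * ⟪w a, x⟫ ^ 2)
      ∂(stdGaussian H) := by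
    rw [integral_sub (integrable_inner_sq_stdGaussian _) j3,
      integral_finsetSum _ fun a _ => (integrable_inner_sq_stdGaussian _).const_mul _]
    simp_rw [integral_const_mul, integral_inner_sq_stdGaussian]
    exact sub_nonneg.2 (hα w fun a => (K a).smul_mem _ (hqK a))
  have := integral_sub (j1.add j5) j6
  have h2 := integral_add j1 j5
  simp only [Pi.add_apply] at this h2
  have h3 := this.trans (congrArg₂ _ (h2.trans (congrArg₂ _ k1
    (by rw [integral_div, integral_const_mul]))) k6)
  refine le_of_le_of_eq ?_ h3.symm
  nlinarith [mul_nonneg (sq_nonneg ε) k4]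

lemma continuous_gaussAvg {u : H → ℝ} {B : ℝ} (hu : Continuous u) (hB : ∀ x, ‖u x‖ ≤ B) (ε : ℝ) :
    Continuous (gaussAvg ε u) :=
  continuous_of_dominated (bound := fun _ => B)
    (fun y => Continuous.aestronglyMeasurable (by fun_prop)) (fun y => ae_of_all _ fun x => hB _)
    (integrable_const B) (ae_of_all _ fun x => by fun_prop)

lemma norm_gaussAvg_le {u : H → ℝ} {B : ℝ} (hB : ∀ x, ‖u x‖ ≤ B) (ε : ℝ) (y : H) :
    ‖gaussAvg ε u y‖ ≤ B := by
  simpa [gaussAvg] using norm_integral_le_of_norm_le_const (μ := stdGaussian H)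
    (ae_of_all _ fun x => hB (y + ε • x))

lemma gaussAvg_gaussAvg {u : H → ℝ} {B : ℝ} (hu : Continuous u) (hB : ∀ x, ‖u x‖ ≤ B)
    {s t r : ℝ} (h : s ^ 2 + t ^ 2 = r ^ 2) (y : H) :
    gaussAvg s (gaussAvg t u) y = gaussAvg r u y := by
  have hi : Integrable (fun z : H × H => u (y + (s • z.1 + t • z.2)))
      ((stdGaussian H).prod (stdGaussian H)) :=
    Integrable.of_bound (C := B) (Continuous.aestronglyMeasurable (by fun_prop))
      (ae_of_all _ fun x => hB _)
  have h1 := integral_prod _ hi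
  have h2 := integral_map (μ := (stdGaussian H).prod (stdGaussian H))
    (φ := fun z => s • z.1 + t • z.2) (f := fun v => u (y + v)) (by fun_prop)
    (Continuous.aestronglyMeasurable (by fun_prop))
  rw [map_add_smul_stdGaussian s t r h, integral_map (by fun_prop)
    (Continuous.aestronglyMeasurable (by fun_prop))] at h2
  simp only [gaussAvg]
  rw [h2, h1]
  simp_rw [add_assoc]

/-- Iterating `exists_prod_gaussAvg_rpow_le`. -/
lemma pow_mul_prod_gaussAvg_rpow_le {ι : Type*} [Fintype ι] {K : ι → Submodule ℝ H} {α : ι → ℝ}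
    {δ N L : ℝ} (hδ : 0 < δ) {C ε : ℝ} (hε1 : C * ε ^ 3 ≤ 1)
    (hstep : ∀ h : ι → H → ℝ, (∀ a, HasTameGradient (K a) δ N L (h a)) → ∀ y,
      (1 - C * ε ^ 3) * ∏ a, gaussAvg ε (h a) y ^ α a ≤
        gaussAvg ε (fun x => ∏ a, h a x ^ α a) y) (n : ℕ) (h : ι → H → ℝ)
    (hh : ∀ a, HasTameGradient (K a) δ N L (h a)) (y : H) :
    (1 - C * ε ^ 3) ^ n * ∏ a, gaussAvg (√n * ε) (h a) y ^ α a ≤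
      gaussAvg (√n * ε) (fun x => ∏ a, h a x ^ α a) y := by
  induction n generalizing h y with
  | zero => simp [gaussAvg]
  | succ n ih =>
    have hr : (√n * ε) ^ 2 + ε ^ 2 = (√(n + 1 : ℕ) * ε) ^ 2 := by
      rw [mul_pow, mul_pow, Real.sq_sqrt (by positivity), Real.sq_sqrt (by positivity)]
      push_cast; ring
    have hb : ∀ x, ‖∏ a, h a x ^ α a‖ ≤ ∏ a, max (δ ^ α a) (N ^ α a) := fun x =>
      abs_prod_rpow_le hδ α _ (fun a => (hh a).lower x) fun a => (hh a).upper x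
    have hc := HasTameGradient.continuous_prod_rpow hδ α hh
    have hA := fun a => (hh a).average ε
    rw [← gaussAvg_gaussAvg hc hb hr]
    have e : ∀ a, gaussAvg (√(n + 1 : ℕ) * ε) (h a) y = gaussAvg (√n * ε) (gaussAvg ε (h a)) y :=
      fun a => (gaussAvg_gaussAvg (hh a).continuous
        (fun x => abs_le_max_abs_abs ((hh a).lower x) ((hh a).upper x)) hr y).symm
    simp_rw [e]
    have h1 := mul_le_mul_of_nonneg_left (ih _ hA y) (sub_nonneg.2 hε1)
    rw [← mul_assoc, ← pow_succ'] at h1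
    refine h1.trans ?_
    simp only [gaussAvg]
    rw [← integral_const_mul]
    exact integral_mono ((HasTameGradient.integrable_prod_rpow hδ α hA y _).const_mul _)
      (integrable_of_continuous_of_bound (continuous_gaussAvg hc hb ε)
        (norm_gaussAvg_le hb ε) y _) fun x => hstep h hh _

lemma prod_integral_rpow_le_of_hasTameGradient {ι : Type*} [Fintype ι] {K : ι → Submodule ℝ H}
    {α : ι → ℝ}
    (hα : ∀ w : ι → H, (∀ a, w a ∈ K a) → ∑ a, α a * ‖w a‖ ^ 2 ≤ ‖∑ a, α a • w a‖ ^ 2)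
    {δ N L : ℝ} (hδ : 0 < δ) (hδN : δ ≤ N) (hL : 0 ≤ L) {h : ι → H → ℝ}
    (hh : ∀ a, HasTameGradient (K a) δ N L (h a)) :
    ∏ a, (∫ x, h a x ∂(stdGaussian H)) ^ α a ≤ ∫ x, ∏ a, h a x ^ α a ∂(stdGaussian H) := by
  obtain ⟨C, hC, hstep⟩ := exists_prod_gaussAvg_rpow_le K α hα hδ hδN hL
  have hlim : Tendsto (fun k : ℕ => (1 - C / k) * ∏ a, (∫ x, h a x ∂(stdGaussian H)) ^ α a) atTop
      (𝓝 ((1 - 0) * ∏ a, (∫ x, h a x ∂(stdGaussian H)) ^ α a)) :=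
    (tendsto_const_nhds.sub (tendsto_const_div_atTop_nhds_zero_nat C)).mul_const _
  rw [sub_zero, one_mul] at hlim
  refine le_of_tendsto hlim ?_
  filter_upwards [eventually_ge_atTop 1, eventually_ge_atTop ⌈C⌉₊] with k hk1 hkC
  have hk1' : (1 : ℝ) ≤ k := by exact_mod_cast hk1
  have hkC' : C ≤ k := Nat.ceil_le.1 hkC
  have hk0 : (0 : ℝ) < k := by linarith
  have hk3 : (k : ℝ) ≤ k ^ 3 := le_self_pow₀ hk1' (by norm_num)
  have hε1 : C * (1 / (k : ℝ)) ^ 3 ≤ 1 := by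
    rw [div_pow, one_pow, mul_one_div, div_le_one (by positivity)]
    linarith
  have key := pow_mul_prod_gaussAvg_rpow_le hδ hε1 (hstep (1 / k) (by positivity)) (k ^ 2) h hh 0
  have hs : √((k ^ 2 : ℕ) : ℝ) * (1 / k) = 1 := by
    push_cast
    rw [Real.sqrt_sq hk0.le, mul_one_div_cancel hk0.ne']
  rw [hs] at key
  simp only [gaussAvg, one_smul, zero_add] at key
  refine le_trans ?_ key
  refine mul_le_mul_of_nonneg_right ?_ (Finset.prod_nonneg fun a _ => Real.rpow_nonneg
    (integral_nonneg fun x => hδ.le.trans ((hh a).lower x)) _)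
  have hB := one_add_mul_le_pow (a := -(C * (1 / (k : ℝ)) ^ 3)) (by linarith) (k ^ 2)
  rw [← sub_eq_add_neg] at hB
  refine le_of_eq_of_le ?_ hB
  push_cast
  field_simp
  ring

/-! ### Smooth approximation of cylindrical functions -/

lemma HasTameGradient.mono {K : Submodule ℝ H} {δ N L L' : ℝ} {h : H → ℝ}
    (hh : HasTameGradient K δ N L h) (hL : L ≤ L') : HasTameGradient K δ N L' h := by
  obtain ⟨p, hpK, hpL, hpLip, hp⟩ := hh.exists_gradient
  refine ⟨hh.lower, hh.upper, fun x y => (hh.lipschitz x y).trans (by gcongr), p, hpK,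
    fun x => (hpL x).trans hL, fun x y => (hpLip x y).trans (by gcongr),
    fun x v => (hp x v).trans (by gcongr)⟩

lemma exists_hasTameGradient_of_contDiff {G : Type*} [NormedAddCommGroup G]
    [InnerProductSpace ℝ G] [FiniteDimensional ℝ G] {δ N : ℝ} {F ψ : G → ℝ} (a : ℝ)
    (hF : ∀ x, F x = a + ψ x) (hψ : ContDiff ℝ 2 ψ)
    (hψc : HasCompactSupport ψ) (hlow : ∀ x, δ ≤ F x) (hup : ∀ x, F x ≤ N) :
    ∃ L, 0 ≤ L ∧ HasTameGradient ⊤ δ N L F := by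
  obtain ⟨L1, hL1⟩ := hψ.lipschitzWith_of_hasCompactSupport hψc (by norm_num)
  have hd : ContDiff ℝ 1 (fderiv ℝ ψ) := hψ.fderiv_right (by norm_num)
  obtain ⟨L2, hL2⟩ := hd.lipschitzWith_of_hasCompactSupport (hψc.fderiv ℝ) (by norm_num)
  have hdiff : Differentiable ℝ ψ := hψ.differentiable (by norm_num)
  have hLa : (L1 : ℝ) ≤ max (L1 : ℝ) L2 := le_max_left _ _
  have hLb : (L2 : ℝ) ≤ max (L1 : ℝ) L2 := le_max_right _ _
  refine ⟨max (L1 : ℝ) L2, le_max_of_le_left L1.2, hlow, hup, fun x y => ?_,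
    fun x => (InnerProductSpace.toDual ℝ G).symm (fderiv ℝ ψ x),
    fun x => trivial, fun x => ?_, fun x y => ?_, fun x v => ?_⟩
  · rw [hF, hF, add_sub_add_left_eq_sub]
    exact (hL1.norm_sub_le x y).trans (by gcongr)
  · rw [LinearIsometryEquiv.norm_map]
    exact (norm_fderiv_le_of_lipschitz ℝ hL1).trans hLa
  · rw [← map_sub, LinearIsometryEquiv.norm_map]
    exact (hL2.norm_sub_le x y).trans (by gcongr)
  · rw [hF, hF, add_sub_add_left_eq_sub, InnerProductSpace.toDual_symm_apply]
    have key := (convex_closedBall x ‖v‖).norm_image_sub_le_of_norm_hasFDerivWithin_le'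
      (f := ψ) (f' := fderiv ℝ ψ) (φ := fderiv ℝ ψ x) (C := L2 * ‖v‖) (x := x) (y := x + v)
      (fun z _ => (hdiff z).hasFDerivAt.hasFDerivWithinAt)
      (fun z hz => (hL2.norm_sub_le z x).trans (by
        gcongr
        simpa [dist_eq_norm] using hz)) (by simp) (by simp)
    rw [add_sub_cancel_left] at key
    refine (Real.norm_eq_abs _).symm.le.trans (key.trans ?_)
    calc L2 * ‖v‖ * ‖v‖ ≤ max (L1 : ℝ) L2 * ‖v‖ * ‖v‖ := by gcongr
      _ = _ := by ring

lemma HasTameGradient.comp_orthogonalProjectionOnto {K : Submodule ℝ H} {δ N L : ℝ} {F : K → ℝ}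
    (hF : HasTameGradient ⊤ δ N L F) (hL : 0 ≤ L) :
    HasTameGradient K δ N L (fun x => F (K.orthogonalProjectionOnto x)) := by
  obtain ⟨p, -, hpL, hpLip, hp⟩ := hF.exists_gradient
  have hP : ∀ x : H, ‖K.orthogonalProjectionOnto x‖ ≤ ‖x‖ := fun x => by
    simpa using K.orthogonalProjectionOnto.le_of_opNorm_le
      (K.orthogonalProjectionOnto_norm_le) x
  have hPs : ∀ x y : H, ‖K.orthogonalProjectionOnto x - K.orthogonalProjectionOnto y‖ ≤
      ‖x - y‖ := fun x y => by
    rw [← map_sub]; exact hP _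
  refine ⟨fun x => hF.lower _, fun x => hF.upper _,
    fun x y => (hF.lipschitz _ _).trans (mul_le_mul_of_nonneg_left (hPs x y) hL),
    fun x => p (K.orthogonalProjectionOnto x), fun x => Submodule.coe_mem _, fun x => hpL _,
    fun x y => (hpLip _ _).trans (mul_le_mul_of_nonneg_left (hPs x y) hL), fun x v => ?_⟩
  have h1 := hp (K.orthogonalProjectionOnto x) (K.orthogonalProjectionOnto v)
  rw [Submodule.inner_orthogonalProjectionOnto_eq_of_mem_left, ← map_add] at h1
  exact h1.trans (mul_le_mul_of_nonneg_left (pow_le_pow_left₀ (norm_nonneg _) (hP v) 2) hL)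

lemma map_orthogonalProjectionOnto_stdGaussian (K : Submodule ℝ H) [BorelSpace K] :
    (stdGaussian H).map K.orthogonalProjectionOnto = stdGaussian K := by
  refine map_stdGaussian_of_coisometry (K.orthogonalProjectionOnto : H →ₗ[ℝ] K) ?_
  have : LinearMap.adjoint (K.orthogonalProjectionOnto : H →ₗ[ℝ] K) = K.subtype := by
    rw [eq_comm, LinearMap.eq_adjoint_iff]
    intro x y
    simp
  rw [this]
  ext x
  simp

lemma exists_seq_hasTameGradient_tendsto (K : Submodule ℝ H) {δ N : ℝ} {h : H → ℝ}
    (hm : Measurable h) (hK : ∀ x, h (K.starProjection x) = h x)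
    (hlow : ∀ x, δ ≤ h x) (hup : ∀ x, h x ≤ N) :
    ∃ (L : ℕ → ℝ) (p : ℕ → H → ℝ), (∀ n, 0 ≤ L n ∧ HasTameGradient K δ N (L n) (p n)) ∧
      ∀ᵐ x ∂(stdGaussian H), Tendsto (fun n => p n x) atTop (𝓝 (h x)) := by
  have hB : BorelSpace K := Subtype.borelSpace (K : Set H)
  set a := (δ + N) / 2 with ha
  set b := (N - δ) / 2 with hb
  have hb0 : 0 ≤ b := by have := (hlow 0).trans (hup 0); simp only [hb]; linarith
  set θ : K → ℝ := fun y => Real.arcsin ((h y - a) / b) with hθ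
  have hθm : Measurable θ := by
    have : Measurable fun y : K => h y := hm.comp measurable_subtype_coe
    exact Real.measurable_arcsin.comp ((this.sub_const a).div_const b)
  have hθsin : ∀ y : K, a + b * Real.sin (θ y) = h y := by
    intro y
    have h1 := hlow y
    have h2 := hup y
    rcases hb0.eq_or_lt with h0 | h0
    · have : δ = N := by simp only [hb] at h0; linarith
      rw [← h0]; simp only [ha]; linarith
    · rw [hθ, Real.sin_arcsin, mul_div_cancel₀]
      · ring
      · exact h0.ne'
      · rw [le_div_iff₀ h0]; simp only [ha, hb]; linarith
      · rw [div_le_iff₀ h0]; simp only [ha, hb]; linarith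
  have hθL : MemLp θ 1 (stdGaussian K) :=
    MemLp.of_bound hθm.aestronglyMeasurable (Real.pi / 2) (ae_of_all _ fun y =>
      abs_le.2 ⟨Real.neg_pi_div_two_le_arcsin _, Real.arcsin_le_pi_div_two _⟩)
  choose φ hφc hφs hφ using fun n : ℕ => hθL.exist_eLpNorm_sub_le ENNReal.one_ne_top le_rfl
    (Nat.one_div_pos_of_nat (α := ℝ) (n := n))
  have hlim : Tendsto (fun n => eLpNorm (φ n - θ) 1 (stdGaussian K)) atTop (𝓝 0) := by
    have : Tendsto (fun n : ℕ => ENNReal.ofReal (1 / ((n : ℝ) + 1))) atTop (𝓝 0) := by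
      have := ENNReal.tendsto_ofReal (tendsto_one_div_add_atTop_nhds_zero_nat (𝕜 := ℝ))
      rwa [ENNReal.ofReal_zero] at this
    refine tendsto_of_tendsto_of_tendsto_of_le_of_le tendsto_const_nhds this
      (fun _ => zero_le) fun n => ?_
    rw [eLpNorm_sub_comm]
    exact hφ n
  obtain ⟨ns, -, hns⟩ := (tendstoInMeasure_of_tendsto_eLpNorm one_ne_zero
    (fun n => (hφs n).continuous.aestronglyMeasurable) hθm.aestronglyMeasurable
    hlim).exists_seq_tendsto_ae
  have hex : ∀ n, ∃ L, 0 ≤ L ∧ HasTameGradient K δ N L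
      (fun x => a + b * Real.sin (φ (ns n) (K.orthogonalProjectionOnto x))) := by
    intro n
    suffices ∃ L, 0 ≤ L ∧ HasTameGradient ⊤ δ N L (fun y => a + b * Real.sin (φ (ns n) y)) from
      this.imp fun L hL => ⟨hL.1, hL.2.comp_orthogonalProjectionOnto hL.1⟩
    refine exists_hasTameGradient_of_contDiff (ψ := fun y => b * Real.sin (φ (ns n) y)) a
      (fun y => rfl) ?_ ?_ (fun y => ?_) (fun y => ?_)
    · have : ContDiff ℝ 2 (φ (ns n)) := (hφs _).of_le (WithTop.coe_le_coe.2 le_top)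
      fun_prop
    · exact (hφc (ns n)).comp_left (g := fun t => b * Real.sin t) (by simp)
    · have := mul_le_mul_of_nonneg_left (Real.neg_one_le_sin (φ (ns n) y)) hb0
      simp only [ha, hb] at *; linarith
    · have := mul_le_mul_of_nonneg_left (Real.sin_le_one (φ (ns n) y)) hb0
      simp only [ha, hb] at *; linarith
  choose L hL0 hL using hex
  refine ⟨L, _, fun n => ⟨hL0 n, hL n⟩, ?_⟩
  rw [← map_orthogonalProjectionOnto_stdGaussian K] at hns
  filter_upwards [ae_of_ae_map (by fun_prop) hns] with x hx
  have h1 := ((Real.continuous_sin.tendsto _).comp hx).const_mul b |>.const_add a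
  rw [hθsin] at h1
  have : h (K.orthogonalProjectionOnto x : H) = h x := hK x
  rw [this] at h1
  exact h1

/-- The Gaussian reverse Hölder inequality for functions bounded away from `0` and `∞`. -/
lemma prod_integral_rpow_le_of_bounded {ι : Type*} [Fintype ι] {K : ι → Submodule ℝ H}
    {α : ι → ℝ}
    (hα : ∀ w : ι → H, (∀ a, w a ∈ K a) → ∑ a, α a * ‖w a‖ ^ 2 ≤ ‖∑ a, α a • w a‖ ^ 2)
    {δ N : ℝ} (hδ : 0 < δ) (hδN : δ ≤ N) {h : ι → H → ℝ} (hm : ∀ a, Measurable (h a))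
    (hK : ∀ a x, h a ((K a).starProjection x) = h a x)
    (hlow : ∀ a x, δ ≤ h a x) (hup : ∀ a x, h a x ≤ N) :
    ∏ a, (∫ x, h a x ∂(stdGaussian H)) ^ α a ≤ ∫ x, ∏ a, h a x ^ α a ∂(stdGaussian H) := by
  choose L p hp hlim using fun a =>
    exists_seq_hasTameGradient_tendsto (K a) (hm a) (hK a) (hlow a) (hup a)
  have hp' : ∀ n a, HasTameGradient (K a) δ N (∑ a, L a n) (p a n) := fun n a =>
    (hp a n).2.mono (Finset.single_le_sum (f := fun a => L a n) (fun b _ => (hp b n).1)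
      (Finset.mem_univ a))
  have hn := fun n => prod_integral_rpow_le_of_hasTameGradient hα hδ hδN
    (Finset.sum_nonneg fun a _ => (hp a n).1) (hp' n)
  have hpos : ∀ a, 0 < ∫ x, h a x ∂(stdGaussian H) := fun a => by
    have hi : Integrable (h a) (stdGaussian H) :=
      Integrable.of_bound (hm a).aestronglyMeasurable (max |δ| |N|)
        (ae_of_all _ fun x => abs_le_max_abs_abs (hlow a x) (hup a x))
    have := integral_mono (integrable_const δ) hi (hlow a)
    simp at this
    exact hδ.trans_le this
  refine le_of_tendsto_of_tendsto' (b := atTop) ?_ ?_ hn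
  · refine tendsto_finsetProd _ fun a _ => Tendsto.rpow_const ?_ (Or.inl (hpos a).ne')
    exact tendsto_integral_of_dominated_convergence (fun _ => max |δ| |N|)
      (fun n => (hp' n a).continuous.aestronglyMeasurable) (integrable_const _)
      (fun n => ae_of_all _ fun x => abs_le_max_abs_abs ((hp' n a).lower x) ((hp' n a).upper x))
      (hlim a)
  · refine tendsto_integral_of_dominated_convergence (fun _ => ∏ a, max (δ ^ α a) (N ^ α a))
      (fun n => (HasTameGradient.continuous_prod_rpow hδ α (hp' n)).aestronglyMeasurable)
      (integrable_const _)
      (fun n => ae_of_all _ fun x => abs_prod_rpow_le hδ α _ (fun a => (hp' n a).lower x)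
        fun a => (hp' n a).upper x) ?_
    filter_upwards [ae_all_iff.2 hlim] with x hx
    exact tendsto_finsetProd _ fun a _ =>
      (hx a).rpow_const (Or.inl (hδ.trans_le (hlow a x)).ne')

/-! ### Extension to arbitrary nonnegative functions -/

lemma tendsto_prod_of_ne_top {ι β : Type*} {l : Filter β} (s : Finset ι) {u : ι → β → ℝ≥0∞}
    {v : ι → ℝ≥0∞} (hu : ∀ a ∈ s, Tendsto (u a) l (𝓝 (v a))) (hv : ∀ a ∈ s, v a ≠ ∞) :
    Tendsto (fun n => ∏ a ∈ s, u a n) l (𝓝 (∏ a ∈ s, v a)) := by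
  classical
  induction s using Finset.induction_on with
  | empty => simpa using tendsto_const_nhds
  | insert a s ha ih =>
    simp_rw [Finset.prod_insert ha]
    have h1 : ∀ b ∈ s, v b ≠ ∞ := fun b hb => hv b (Finset.mem_insert_of_mem hb)
    exact ENNReal.Tendsto.mul (hu a (Finset.mem_insert_self a s))
      (Or.inr (ENNReal.prod_ne_top h1))
      (ih (fun b hb => hu b (Finset.mem_insert_of_mem hb)) h1)
      (Or.inr (hv a (Finset.mem_insert_self a s)))

lemma tendsto_prod_of_ne_zero {ι β : Type*} {l : Filter β} (s : Finset ι) {u : ι → β → ℝ≥0∞}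
    {v : ι → ℝ≥0∞} (hu : ∀ a ∈ s, Tendsto (u a) l (𝓝 (v a))) (hv : ∀ a ∈ s, v a ≠ 0) :
    Tendsto (fun n => ∏ a ∈ s, u a n) l (𝓝 (∏ a ∈ s, v a)) := by
  classical
  induction s using Finset.induction_on with
  | empty => simpa using tendsto_const_nhds
  | insert a s ha ih =>
    simp_rw [Finset.prod_insert ha]
    have h1 : ∀ b ∈ s, v b ≠ 0 := fun b hb => hv b (Finset.mem_insert_of_mem hb)
    exact ENNReal.Tendsto.mul (hu a (Finset.mem_insert_self a s))
      (Or.inl (hv a (Finset.mem_insert_self a s)))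
      (ih (fun b hb => hu b (Finset.mem_insert_of_mem hb)) h1)
      (Or.inl (Finset.prod_ne_zero_iff.2 h1))

variable {ι : Type*} [Fintype ι] {K : ι → Submodule ℝ H} {α : ι → ℝ}

lemma prod_lintegral_rpow_le_of_bounded
    (hα : ∀ w : ι → H, (∀ a, w a ∈ K a) → ∑ a, α a * ‖w a‖ ^ 2 ≤ ‖∑ a, α a • w a‖ ^ 2)
    {δ N : ℝ≥0} (hδ : 0 < δ) (hδN : δ ≤ N) {h : ι → H → ℝ≥0} (hm : ∀ a, Measurable (h a))
    (hK : ∀ a x, h a ((K a).starProjection x) = h a x)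
    (hlow : ∀ a x, δ ≤ h a x) (hup : ∀ a x, h a x ≤ N) :
    ∏ a, (∫⁻ x, (h a x : ℝ≥0∞) ∂(stdGaussian H)) ^ α a ≤
      ∫⁻ x, ∏ a, (h a x : ℝ≥0∞) ^ α a ∂(stdGaussian H) := by
  have hreal := prod_integral_rpow_le_of_bounded hα (δ := δ) (N := N) (by exact_mod_cast hδ)
    (by exact_mod_cast hδN) (h := fun a x => (h a x : ℝ)) (fun a => (hm a).coe_nnreal_real)
    (fun a x => by simp only [hK]) (fun a x => by exact_mod_cast hlow a x)
    (fun a x => by exact_mod_cast hup a x)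
  have hpos : ∀ a x, 0 < (h a x : ℝ) := fun a x => by exact_mod_cast hδ.trans_le (hlow a x)
  have hi : ∀ a, Integrable (fun x => (h a x : ℝ)) (stdGaussian H) := fun a =>
    Integrable.of_bound (hm a).coe_nnreal_real.aestronglyMeasurable N
      (ae_of_all _ fun x => by
        rw [Real.norm_of_nonneg (h a x).coe_nonneg]; exact_mod_cast hup a x)
  have hipos : ∀ a, 0 < ∫ x, (h a x : ℝ) ∂(stdGaussian H) := fun a => by
    have := integral_mono (integrable_const (δ : ℝ)) (hi a)
      (fun x => by exact_mod_cast hlow a x)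
    simp at this
    exact lt_of_lt_of_le (by exact_mod_cast hδ) this
  have hl : ∀ a, ∫⁻ x, (h a x : ℝ≥0∞) ∂(stdGaussian H) =
      ENNReal.ofReal (∫ x, (h a x : ℝ) ∂(stdGaussian H)) := fun a => by
    rw [ofReal_integral_eq_lintegral_ofReal (hi a) (ae_of_all _ fun x => (hpos a x).le)]
    simp
  have hr : ∀ x, ∏ a, (h a x : ℝ≥0∞) ^ α a = ENNReal.ofReal (∏ a, (h a x : ℝ) ^ α a) := by
    intro x
    rw [ENNReal.ofReal_prod_of_nonneg fun a _ => Real.rpow_nonneg (hpos a x).le _]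
    refine Finset.prod_congr rfl fun a _ => ?_
    rw [← ENNReal.ofReal_rpow_of_pos (hpos a x), ENNReal.ofReal_coe_nnreal]
  simp_rw [hl, hr]
  have hδ' : (0 : ℝ) < δ := by exact_mod_cast hδ
  rw [← ofReal_integral_eq_lintegral_ofReal]
  · have : ∏ a, ENNReal.ofReal (∫ x, (h a x : ℝ) ∂(stdGaussian H)) ^ α a =
        ENNReal.ofReal (∏ a, (∫ x, (h a x : ℝ) ∂(stdGaussian H)) ^ α a) := by
      rw [ENNReal.ofReal_prod_of_nonneg fun a _ => Real.rpow_nonneg (hipos a).le _]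
      exact Finset.prod_congr rfl fun a _ => ENNReal.ofReal_rpow_of_pos (hipos a)
    rw [this]
    exact ENNReal.ofReal_le_ofReal hreal
  · refine Integrable.of_bound (C := ∏ a, max ((δ : ℝ) ^ α a) ((N : ℝ) ^ α a)) ?_
      (ae_of_all _ fun x => abs_prod_rpow_le hδ' α _ (fun a => by exact_mod_cast hlow a x)
        fun a => by exact_mod_cast hup a x)
    exact (Finset.measurable_prod _ fun a _ =>
      (hm a).coe_nnreal_real.pow_const _).aestronglyMeasurable
  · exact ae_of_all _ fun x => Finset.prod_nonneg fun a _ => Real.rpow_nonneg (hpos a x).le _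

lemma rpow_le_rpow_of_nonpos_ennreal {x y : ℝ≥0∞} {r : ℝ} (hr : r ≤ 0) (h : x ≤ y) :
    y ^ r ≤ x ^ r := by
  have := ENNReal.inv_le_inv.2 (ENNReal.rpow_le_rpow h (neg_nonneg.2 hr))
  simpa [ENNReal.rpow_neg] using this

lemma tendsto_one_div_add_one_nnreal :
    Tendsto (fun n : ℕ => 1 / ((n : ℝ≥0) + 1)) atTop (𝓝 0) := by
  have := tendsto_one_div_add_atTop_nhds_zero_nat (𝕜 := ℝ)
  rw [← NNReal.tendsto_coe]
  simpa using this

lemma tendsto_lintegral_add_one_div {Ω : Type*} [MeasurableSpace Ω] {μ : Measure Ω}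
    [IsProbabilityMeasure μ] (h : Ω → ℝ≥0) :
    Tendsto (fun n : ℕ => ∫⁻ x, ((h x + 1 / ((n : ℝ≥0) + 1) : ℝ≥0) : ℝ≥0∞) ∂μ) atTop
      (𝓝 (∫⁻ x, (h x : ℝ≥0∞) ∂μ)) := by
  have h1 : ∀ n : ℕ, ∫⁻ x, ((h x + 1 / ((n : ℝ≥0) + 1) : ℝ≥0) : ℝ≥0∞) ∂μ =
      ∫⁻ x, (h x : ℝ≥0∞) ∂μ + ((1 / ((n : ℝ≥0) + 1) : ℝ≥0) : ℝ≥0∞) := fun n => by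
    simp_rw [ENNReal.coe_add]
    rw [lintegral_add_right _ measurable_const]
    simp
  simp_rw [h1]
  have h2 := (ENNReal.tendsto_coe.2 tendsto_one_div_add_one_nnreal).const_add
    (∫⁻ x, (h x : ℝ≥0∞) ∂μ)
  simpa using h2

lemma tendsto_lintegral_min {Ω : Type*} [MeasurableSpace Ω] {μ : Measure Ω} {h : Ω → ℝ≥0}
    (hm : Measurable h) :
    Tendsto (fun n : ℕ => ∫⁻ x, ((min (h x) n : ℝ≥0) : ℝ≥0∞) ∂μ) atTop
      (𝓝 (∫⁻ x, (h x : ℝ≥0∞) ∂μ)) := by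
  refine lintegral_tendsto_of_tendsto_of_monotone (fun n => by fun_prop)
    (ae_of_all _ fun x n m hnm => ?_) (ae_of_all _ fun x => ?_)
  · exact ENNReal.coe_le_coe.2 (min_le_min_left _ (by exact_mod_cast hnm))
  · refine tendsto_const_nhds.congr' ?_
    filter_upwards [eventually_ge_atTop ⌈h x⌉₊] with n hn
    rw [min_eq_left (Nat.ceil_le.1 hn)]

lemma prod_lintegral_rpow_le_of_semibounded
    (hα : ∀ w : ι → H, (∀ a, w a ∈ K a) → ∑ a, α a * ‖w a‖ ^ 2 ≤ ‖∑ a, α a • w a‖ ^ 2)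
    {δ N : ℝ≥0} (hδ : 0 < δ) {h : ι → H → ℝ≥0} (hm : ∀ a, Measurable (h a))
    (hK : ∀ a x, h a ((K a).starProjection x) = h a x)
    (hup : ∀ a, 0 < α a → ∀ x, h a x ≤ N) (hlow : ∀ a, ¬ 0 < α a → ∀ x, δ ≤ h a x) :
    ∏ a, (∫⁻ x, (h a x : ℝ≥0∞) ∂(stdGaussian H)) ^ α a ≤
      ∫⁻ x, ∏ a, (h a x : ℝ≥0∞) ^ α a ∂(stdGaussian H) := by
  set u : ℕ → ι → H → ℝ≥0 := fun n a x =>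
    if 0 < α a then h a x + 1 / ((n : ℝ≥0) + 1) else min (h a x) n with hu
  have hum : ∀ n a, Measurable (u n a) := fun n a => by
    simp only [hu]; split_ifs <;> have := hm a <;> fun_prop
  have hδ0 : (δ : ℝ≥0∞) ≠ 0 := by exact_mod_cast hδ.ne'
  have hn : ∀ᶠ n : ℕ in atTop, ∏ a, (∫⁻ x, (u n a x : ℝ≥0∞) ∂(stdGaussian H)) ^ α a ≤
      ∫⁻ x, ∏ a, (u n a x : ℝ≥0∞) ^ α a ∂(stdGaussian H) := by
    filter_upwards [eventually_ge_atTop ⌈δ⌉₊] with n hn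
    have hn' : δ ≤ n := Nat.ceil_le.1 hn
    refine prod_lintegral_rpow_le_of_bounded hα (δ := min δ (1 / ((n : ℝ≥0) + 1)))
      (N := max (N + 1) n) (lt_min hδ (by positivity))
      ((min_le_left _ _).trans (hn'.trans (le_max_right _ _))) (hum n)
      (fun a x => by simp only [hu, hK]) (fun a x => ?_) (fun a x => ?_)
    · simp only [hu]
      split_ifs with ha
      · exact (min_le_right _ _).trans le_add_self
      · exact (min_le_left _ _).trans (le_min (hlow a ha x) hn')
    · simp only [hu]
      split_ifs with ha
      · refine le_max_of_le_left (add_le_add (hup a ha x) ?_)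
        rw [div_le_one (by positivity)]
        exact le_add_self
      · exact le_max_of_le_right (min_le_right _ _)
  refine le_of_tendsto_of_tendsto ?_ ?_ hn
  · refine tendsto_prod_of_ne_top _ (fun a _ => ?_) (fun a _ => ?_)
    · refine (ENNReal.continuous_rpow_const.tendsto _).comp ?_
      simp only [hu]
      split_ifs with ha
      · exact tendsto_lintegral_add_one_div (h a)
      · exact tendsto_lintegral_min (hm a)
    · by_cases ha : 0 < α a
      · refine ENNReal.rpow_ne_top_of_nonneg ha.le (ne_top_of_le_ne_top (ENNReal.coe_ne_top (r := N)) ?_)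
        calc ∫⁻ x, (h a x : ℝ≥0∞) ∂(stdGaussian H) ≤ ∫⁻ x, (N : ℝ≥0∞) ∂(stdGaussian H) :=
              lintegral_mono fun x => ENNReal.coe_le_coe.2 (hup a ha x)
          _ = N := by simp
      · have : (δ : ℝ≥0∞) ≤ ∫⁻ x, (h a x : ℝ≥0∞) ∂(stdGaussian H) :=
          calc (δ : ℝ≥0∞) = ∫⁻ x, (δ : ℝ≥0∞) ∂(stdGaussian H) := by simp
            _ ≤ _ := lintegral_mono fun x => ENNReal.coe_le_coe.2 (hlow a ha x)
        rw [Ne, ENNReal.rpow_eq_top_iff]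
        rintro (⟨h0, -⟩ | ⟨-, h0⟩)
        · exact hδ0 (le_antisymm (h0 ▸ this) zero_le)
        · exact ha h0
  · set b : ι → ℝ≥0∞ := fun a => if 0 < α a then ((N + 1 : ℝ≥0) : ℝ≥0∞) ^ α a
      else (δ : ℝ≥0∞) ^ α a with hb
    have hbt : ∀ a, b a ≠ ∞ := fun a => by
      simp only [hb]
      split_ifs with ha
      · exact ENNReal.rpow_ne_top_of_nonneg ha.le ENNReal.coe_ne_top
      · rw [← ENNReal.coe_rpow_of_ne_zero hδ.ne']; exact ENNReal.coe_ne_top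
    have hlim : ∀ a x, Tendsto (fun n => (u n a x : ℝ≥0∞) ^ α a) atTop
        (𝓝 ((h a x : ℝ≥0∞) ^ α a)) := fun a x => by
      refine (ENNReal.continuous_rpow_const.tendsto _).comp (ENNReal.tendsto_coe.2 ?_)
      simp only [hu]
      split_ifs with ha
      · simpa using tendsto_one_div_add_one_nnreal.const_add (h a x)
      · refine tendsto_const_nhds.congr' ?_
        filter_upwards [eventually_ge_atTop ⌈h a x⌉₊] with n hn
        rw [min_eq_left (Nat.ceil_le.1 hn)]
    refine tendsto_lintegral_filter_of_dominated_convergence (fun _ => ∏ a, b a)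
      (Eventually.of_forall fun n => Finset.measurable_prod _ fun a _ =>
        (hum n a).coe_nnreal_ennreal.pow_const _) ?_ ?_
      (ae_of_all _ fun x => tendsto_prod_of_ne_top _ (fun a _ => hlim a x) fun a _ => ?_)
    · filter_upwards [eventually_ge_atTop ⌈δ⌉₊] with n hn
      have hn' : δ ≤ n := Nat.ceil_le.1 hn
      refine ae_of_all _ fun x => Finset.prod_le_prod' fun a _ => ?_
      simp only [hu, hb]
      split_ifs with ha
      · refine ENNReal.rpow_le_rpow (ENNReal.coe_le_coe.2 (add_le_add (hup a ha x) ?_)) ha.le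
        rw [div_le_one (by positivity)]
        exact le_add_self
      · exact rpow_le_rpow_of_nonpos_ennreal (not_lt.1 ha)
          (ENNReal.coe_le_coe.2 (le_min (hlow a ha x) hn'))
    · simpa using ENNReal.prod_ne_top fun a _ => hbt a
    · by_cases ha : 0 < α a
      · exact ENNReal.rpow_ne_top_of_nonneg ha.le ENNReal.coe_ne_top
      · rw [← ENNReal.coe_rpow_of_ne_zero (hδ.trans_le (hlow a ha x)).ne']
        exact ENNReal.coe_ne_top

/-- **Gaussian reverse Hölder inequality.** -/
theorem prod_lintegral_rpow_le
    (hα : ∀ w : ι → H, (∀ a, w a ∈ K a) → ∑ a, α a * ‖w a‖ ^ 2 ≤ ‖∑ a, α a • w a‖ ^ 2)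
    {h : ι → H → ℝ≥0} (hm : ∀ a, Measurable (h a))
    (hK : ∀ a x, h a ((K a).starProjection x) = h a x) :
    ∏ a, (∫⁻ x, (h a x : ℝ≥0∞) ∂(stdGaussian H)) ^ α a ≤
      ∫⁻ x, ∏ a, (h a x : ℝ≥0∞) ^ α a ∂(stdGaussian H) := by
  by_cases h0 : ∃ a, (∫⁻ x, (h a x : ℝ≥0∞) ∂(stdGaussian H)) ^ α a = 0
  · obtain ⟨a, ha⟩ := h0
    rw [Finset.prod_eq_zero (Finset.mem_univ a) ha]
    exact zero_le
  push Not at h0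
  set u : ℕ → ι → H → ℝ≥0 := fun n a x =>
    if 0 < α a then min (h a x) n else h a x + 1 / ((n : ℝ≥0) + 1) with hu
  have hum : ∀ n a, Measurable (u n a) := fun n a => by
    simp only [hu]; split_ifs <;> have := hm a <;> fun_prop
  have hn : ∀ n : ℕ, ∏ a, (∫⁻ x, (u n a x : ℝ≥0∞) ∂(stdGaussian H)) ^ α a ≤
      ∫⁻ x, ∏ a, (h a x : ℝ≥0∞) ^ α a ∂(stdGaussian H) := by
    intro n
    refine (prod_lintegral_rpow_le_of_semibounded hα (δ := 1 / ((n : ℝ≥0) + 1))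
      (N := n) (by positivity) (hum n)
      (fun a x => by simp only [hu, hK]) (fun a ha x => ?_) (fun a ha x => ?_)).trans
      (lintegral_mono fun x => Finset.prod_le_prod' fun a _ => ?_)
    · simp only [hu, if_pos ha]
      exact min_le_right _ _
    · simp only [hu, if_neg ha]
      exact le_add_self
    · simp only [hu]
      split_ifs with ha
      · exact ENNReal.rpow_le_rpow (ENNReal.coe_le_coe.2 (min_le_left _ _)) ha.le
      · exact rpow_le_rpow_of_nonpos_ennreal (not_lt.1 ha) (ENNReal.coe_le_coe.2 le_self_add)
  refine le_of_tendsto' (x := atTop) (tendsto_prod_of_ne_zero _ (fun a _ => ?_) (fun a _ => h0 a)) hn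
  refine (ENNReal.continuous_rpow_const.tendsto _).comp ?_
  simp only [hu]
  split_ifs with ha
  · exact tendsto_lintegral_min (hm a)
  · exact tendsto_lintegral_add_one_div (h a)

end Averages

/-! ### The linear-algebraic hypothesis -/

section LinearAlgebra

variable {H : Type*} [NormedAddCommGroup H] [InnerProductSpace ℝ H] [FiniteDimensional ℝ H]

/-- A symmetric operator is positive definite on a subspace and negative semidefinite on a
complementary one. -/
lemma exists_pos_nonpos_subspaces {Q : H →ₗ[ℝ] H} (hQ : Q.IsSymmetric) :
    ∃ W W' : Submodule ℝ H, (∀ x ∈ W, x ≠ 0 → 0 < ⟪Q x, x⟫) ∧ (∀ x ∈ W', ⟪Q x, x⟫ ≤ 0) ∧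
      Module.finrank ℝ W + Module.finrank ℝ W' = Module.finrank ℝ H := by
  set b := hQ.eigenvectorBasis rfl with hb
  set l := hQ.eigenvalues rfl with hl
  have hquad : ∀ x, ⟪Q x, x⟫ = ∑ i, l i * ⟪b i, x⟫ ^ 2 := fun x => by
    rw [← b.sum_inner_mul_inner (Q x) x]
    refine Finset.sum_congr rfl fun i _ => ?_
    rw [hQ x (b i), hb, hQ.apply_eigenvectorBasis rfl i, inner_smul_right,
      real_inner_comm x]
    simp only [RCLike.ofReal_real_eq_id, id_eq]
    ring
  set W := Submodule.span ℝ (b '' {i | 0 < l i}) with hW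
  have h1 : ∀ x ∈ W, ∀ i, ¬ 0 < l i → ⟪b i, x⟫ = 0 := by
    intro x hx i hi
    have : W ≤ (Submodule.span ℝ {b i})ᗮ := by
      rw [hW, Submodule.span_le]
      rintro _ ⟨j, hj, rfl⟩
      rw [SetLike.mem_coe, Submodule.mem_orthogonal_singleton_iff_inner_right]
      exact b.inner_eq_zero (by rintro rfl; exact hi hj)
    exact Submodule.mem_orthogonal_singleton_iff_inner_right.1 (this hx)
  refine ⟨W, Wᗮ, fun x hx hx0 => ?_, fun x hx => ?_, W.finrank_add_finrank_orthogonal⟩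
  · rw [hquad]
    have hnn : ∀ i, 0 ≤ l i * ⟪b i, x⟫ ^ 2 := fun i => by
      by_cases hi : 0 < l i
      · positivity
      · rw [h1 x hx i hi]; simp
    refine Finset.sum_pos' (fun i _ => hnn i) ?_
    by_contra hcon
    push Not at hcon
    apply hx0
    have h2 : ∀ i, ⟪b i, x⟫ = 0 := fun i => by
      by_cases hi : 0 < l i
      · have := le_antisymm (hcon i (Finset.mem_univ i)) (hnn i)
        simpa [hi.ne'] using this
      · exact h1 x hx i hi
    have := b.sum_sq_norm_inner_right x
    simpa [h2] using this.symm
  · rw [hquad]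
    refine Finset.sum_nonpos fun i _ => ?_
    by_cases hi : 0 < l i
    · have : ⟪b i, x⟫ = 0 := (Submodule.mem_orthogonal _ _).1 hx _
        (Submodule.subset_span ⟨i, hi, rfl⟩)
      rw [this]; simp
    · exact mul_nonpos_of_nonpos_of_nonneg (not_lt.1 hi) (sq_nonneg _)

lemma sum_mul_norm_sq_sub_le {ι κ : Type*} [Fintype ι] [Fintype κ] {E : ι → Type*} {F : κ → Type*}
    [∀ i, NormedAddCommGroup (E i)] [∀ i, InnerProductSpace ℝ (E i)]
    [∀ i, FiniteDimensional ℝ (E i)]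
    [∀ j, NormedAddCommGroup (F j)] [∀ j, InnerProductSpace ℝ (F j)]
    [∀ j, FiniteDimensional ℝ (F j)] {c : ι → ℝ} {d : κ → ℝ} (hd : ∀ j, 0 ≤ d j)
    {Q : H →ₗ[ℝ] H} {U : ∀ i, H →ₗ[ℝ] E i} {V : ∀ j, H →ₗ[ℝ] F j}
    (hquad : ∀ x, ⟪Q x, x⟫ + ∑ i, c i * ‖U i x‖ ^ 2 = ∑ j, d j * ‖V j x‖ ^ 2 + ‖x‖ ^ 2)
    {W : Submodule ℝ H} (hW : ∀ x ∈ W, ⟪Q x, x⟫ ≤ 0)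
    (hdim : ∑ i, Module.finrank ℝ (E i) ≤ Module.finrank ℝ W)
    (y : ∀ i, E i) (z : ∀ j, F j) :
    ∑ i, c i * ‖y i‖ ^ 2 - ∑ j, d j * ‖z j‖ ^ 2 ≤
      ‖∑ i, c i • LinearMap.adjoint (U i) (y i) - ∑ j, d j • LinearMap.adjoint (V j) (z j)‖ ^ 2 := by
  by_contra! hlt
  set w := ∑ i, c i • LinearMap.adjoint (U i) (y i) - ∑ j, d j • LinearMap.adjoint (V j) (z j)
    with hw
  set Φ : W × ℝ →ₗ[ℝ] ∀ i, E i := LinearMap.pi fun i =>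
    (U i ∘ₗ W.subtype).coprod (LinearMap.toSpanSingleton ℝ (E i) (y i)) with hΦ
  have hker : LinearMap.ker Φ ≠ ⊥ := by
    apply LinearMap.ker_ne_bot_of_finrank_lt
    rw [Module.finrank_pi_fintype, Module.finrank_prod, Module.finrank_self]
    lia
  obtain ⟨⟨x, t⟩, hxt, hne⟩ := Submodule.exists_mem_ne_zero_of_ne_bot hker
  have hU : ∀ i, U i x = -(t • y i) := fun i => by
    have := congrFun (LinearMap.mem_ker.1 hxt) i
    simp only [hΦ, LinearMap.pi_apply, LinearMap.coprod_apply, LinearMap.comp_apply,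
      LinearMap.toSpanSingleton_apply, Pi.zero_apply, Submodule.subtype_apply] at this
    exact eq_neg_of_add_eq_zero_left this
  have hwx : ⟪w, (x : H)⟫ = -(t * ∑ i, c i * ‖y i‖ ^ 2) - ∑ j, d j * ⟪z j, V j x⟫ := by
    simp only [hw, inner_sub_left, sum_inner, real_inner_smul_left,
      LinearMap.adjoint_inner_left, hU, inner_neg_right, real_inner_smul_right,
      real_inner_self_eq_norm_sq]
    rw [Finset.mul_sum, ← Finset.sum_neg_distrib]
    congr 1
    exact Finset.sum_congr rfl fun i _ => by ring
  have hVz : ∑ j, d j * ‖t • z j + V j x‖ ^ 2 = t ^ 2 * ∑ j, d j * ‖z j‖ ^ 2 +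
      2 * t * ∑ j, d j * ⟪z j, V j x⟫ + ∑ j, d j * ‖V j x‖ ^ 2 := by
    simp only [norm_add_sq_real, real_inner_smul_left, norm_smul, mul_pow, Real.norm_eq_abs,
      sq_abs]
    rw [Finset.mul_sum, Finset.mul_sum, ← Finset.sum_add_distrib, ← Finset.sum_add_distrib]
    exact Finset.sum_congr rfl fun i _ => by ring
  have hUy : ∑ i, c i * ‖U i x‖ ^ 2 = t ^ 2 * ∑ i, c i * ‖y i‖ ^ 2 := by
    simp only [hU, norm_neg, norm_smul, mul_pow, Real.norm_eq_abs, sq_abs]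
    rw [Finset.mul_sum]
    exact Finset.sum_congr rfl fun i _ => by ring
  have hxw : ‖(x : H) + t • w‖ ^ 2 = ‖(x : H)‖ ^ 2 + 2 * t * ⟪w, (x : H)⟫ + t ^ 2 * ‖w‖ ^ 2 := by
    rw [norm_add_sq_real, real_inner_smul_right, real_inner_comm, norm_smul, mul_pow,
      Real.norm_eq_abs, sq_abs]
    ring
  have hq := hquad x
  have hV0 : 0 ≤ ∑ j, d j * ‖t • z j + V j x‖ ^ 2 :=
    Finset.sum_nonneg fun j _ => mul_nonneg (hd j) (sq_nonneg _)
  have hQx := hW x x.2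
  rw [hUy] at hq
  rw [hwx] at hxw
  have hfinal : ‖(x : H) + t • w‖ ^ 2 +
      t ^ 2 * (∑ i, c i * ‖y i‖ ^ 2 - ∑ j, d j * ‖z j‖ ^ 2 - ‖w‖ ^ 2) ≤ 0 := by
    rw [hxw]
    linarith
  have hη := sub_pos.2 hlt
  have ht : t = 0 := by
    by_contra ht
    have := mul_pos (pow_pos (abs_pos.2 ht) 2) hη
    rw [sq_abs] at this
    linarith [sq_nonneg ‖(x : H) + t • w‖]
  rw [ht, zero_smul, add_zero] at hfinal
  have hx : (x : H) = 0 := by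
    have : ‖(x : H)‖ ^ 2 ≤ 0 := by linarith
    simpa using le_antisymm this (sq_nonneg _)
  exact hne (Prod.ext (Subtype.ext hx) ht)

end LinearAlgebra

/-! ### Lebesgue integrals as Gaussian integrals -/

section ChangeOfDensity

variable {G : Type*} [NormedAddCommGroup G] [InnerProductSpace ℝ G] [FiniteDimensional ℝ G]
  [MeasurableSpace G] [BorelSpace G]

lemma integrable_exp_neg_pi_mul_norm_sq :
    Integrable fun x : G => Real.exp (-(Real.pi * ‖x‖ ^ 2)) := by
  have h := (GaussianFourier.integrable_cexp_neg_mul_sq_norm_add (V := G) (b := Real.pi)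
    (by simpa using Real.pi_pos) 0 0).norm
  refine h.congr (ae_of_all _ fun x => ?_)
  simp only [Complex.norm_exp]
  congr 1
  simp [← Complex.ofReal_pow]

lemma map_smul_stdGaussian_eq_withDensity :
    (stdGaussian G).map (fun x => (√(2 * Real.pi))⁻¹ • x) =
      volume.withDensity fun x => ((Real.exp (-(Real.pi * ‖x‖ ^ 2))).toNNReal : ℝ≥0∞) := by
  have hpi := Real.pi_pos
  have : IsFiniteMeasure (volume.withDensity fun x : G =>
      ((Real.exp (-(Real.pi * ‖x‖ ^ 2))).toNNReal : ℝ≥0∞)) :=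
    isFiniteMeasure_withDensity_ofReal integrable_exp_neg_pi_mul_norm_sq.2
  refine Measure.ext_of_charFun (funext fun t => ?_)
  rw [charFun_map_smul, charFun_stdGaussian, charFun_apply,
    integral_withDensity_eq_integral_smul (by fun_prop)]
  have h := GaussianFourier.integral_cexp_neg_mul_sq_norm_add (V := G) (b := Real.pi)
    (by simpa using Real.pi_pos) Complex.I t
  rw [div_self (by exact_mod_cast hpi.ne'), Complex.one_cpow, one_mul] at h
  have hint : ∀ x : G, (Real.exp (-(Real.pi * ‖x‖ ^ 2))).toNNReal •
      Complex.exp (⟪x, t⟫ * Complex.I) =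
      Complex.exp (-Real.pi * ‖x‖ ^ 2 + Complex.I * ⟪t, x⟫) := fun x => by
    rw [NNReal.smul_def, Real.coe_toNNReal _ (Real.exp_pos _).le, Complex.real_smul,
      Complex.ofReal_exp, ← Complex.exp_add, real_inner_comm]
    congr 1
    push_cast
    ring
  simp only [hint]
  rw [h, norm_smul, Real.norm_eq_abs, abs_of_pos (by positivity), Complex.I_sq]
  congr 1
  have hs : ((√(2 * Real.pi))⁻¹ * ‖t‖) ^ 2 = ‖t‖ ^ 2 / (2 * Real.pi) := by
    rw [mul_pow, inv_pow, Real.sq_sqrt (by positivity)]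
    ring
  rw [← Complex.ofReal_pow, hs]
  push_cast
  have : (Real.pi : ℂ) ≠ 0 := by exact_mod_cast hpi.ne'
  field_simp
  norm_num

/-- Lebesgue integrals as integrals against the standard Gaussian measure. -/
lemma lintegral_eq_lintegral_stdGaussian {φ : G → ℝ≥0∞} (hφ : Measurable φ) :
    ∫⁻ x, φ x = ∫⁻ x, φ ((√(2 * Real.pi))⁻¹ • x) *
      ((Real.exp (Real.pi * ‖(√(2 * Real.pi))⁻¹ • x‖ ^ 2)).toNNReal : ℝ≥0∞)
        ∂(stdGaussian G) := by
  have hm : Measurable fun x : G =>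
      φ x * ((Real.exp (Real.pi * ‖x‖ ^ 2)).toNNReal : ℝ≥0∞) := by fun_prop
  rw [← lintegral_map (μ := stdGaussian G) (g := fun x => (√(2 * Real.pi))⁻¹ • x) hm
    (by fun_prop), map_smul_stdGaussian_eq_withDensity,
    lintegral_withDensity_eq_lintegral_mul _ (by fun_prop) hm]
  refine lintegral_congr fun x => ?_
  rw [Pi.mul_apply, mul_left_comm, ← ENNReal.coe_mul, ← Real.toNNReal_mul (Real.exp_pos _).le,
    ← Real.exp_add]
  simp

end ChangeOfDensity

/-! ### The Lebesgue form of the inequality -/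

section Lebesgue

variable {H : Type*} [NormedAddCommGroup H] [InnerProductSpace ℝ H] [FiniteDimensional ℝ H]
  {G : Type*} [NormedAddCommGroup G] [InnerProductSpace ℝ G] [FiniteDimensional ℝ G]

lemma norm_adjoint_apply_of_coisometry {M : H →ₗ[ℝ] G}
    (hM : M ∘ₗ LinearMap.adjoint M = LinearMap.id) (y : G) : ‖LinearMap.adjoint M y‖ = ‖y‖ := by
  rw [← sq_eq_sq₀ (norm_nonneg _) (norm_nonneg _), ← real_inner_self_eq_norm_sq,
    LinearMap.adjoint_inner_left, ← LinearMap.comp_apply, hM, LinearMap.id_apply,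
    real_inner_self_eq_norm_sq]

lemma apply_starProjection_range_adjoint (M : H →ₗ[ℝ] G) (x : H) :
    M ((LinearMap.adjoint M).range.starProjection x) = M x := by
  have h := Submodule.sub_starProjection_mem_orthogonal (K := (LinearMap.adjoint M).range) x
  rw [LinearMap.orthogonal_range, LinearMap.adjoint_adjoint, LinearMap.mem_ker, map_sub,
    sub_eq_zero] at h
  exact h.symm

/-- The function `f ∘ M`, rescaled and divided by the Gaussian weight. -/
def gaussLift (M : H →ₗ[ℝ] G) (f : G → ℝ≥0) (x : H) : ℝ≥0 :=
  f (M ((√(2 * Real.pi))⁻¹ • x)) *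
    (Real.exp (Real.pi * ‖M ((√(2 * Real.pi))⁻¹ • x)‖ ^ 2)).toNNReal

lemma gaussLift_starProjection (M : H →ₗ[ℝ] G) (f : G → ℝ≥0) (x : H) :
    gaussLift M f ((LinearMap.adjoint M).range.starProjection x) = gaussLift M f x := by
  simp only [gaussLift, map_smul, apply_starProjection_range_adjoint]

lemma gaussLift_rpow (M : H →ₗ[ℝ] G) (f : G → ℝ≥0) (x : H) (r : ℝ) :
    (gaussLift M f x : ℝ≥0∞) ^ r = (f (M ((√(2 * Real.pi))⁻¹ • x)) : ℝ≥0∞) ^ r *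
      ENNReal.ofReal (Real.exp (Real.pi * (r * ‖M ((√(2 * Real.pi))⁻¹ • x)‖ ^ 2))) := by
  have hne : (Real.exp (Real.pi * ‖M ((√(2 * Real.pi))⁻¹ • x)‖ ^ 2)).toNNReal ≠ 0 :=
    (Real.toNNReal_pos.2 (Real.exp_pos _)).ne'
  rw [gaussLift, ENNReal.coe_mul, ENNReal.mul_rpow_of_ne_top ENNReal.coe_ne_top
    ENNReal.coe_ne_top]
  congr 1
  change ENNReal.ofReal _ ^ r = _
  rw [ENNReal.ofReal_rpow_of_pos (Real.exp_pos _), ← Real.exp_mul]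
  congr 2
  ring

variable [MeasurableSpace H] [BorelSpace H] [MeasurableSpace G] [BorelSpace G]

lemma measurable_gaussLift (M : H →ₗ[ℝ] G) {f : G → ℝ≥0} (hf : Measurable f) :
    Measurable (gaussLift M f) := by
  have hM : Measurable M := (LinearMap.continuous_of_finiteDimensional M).measurable
  unfold gaussLift
  fun_prop

lemma lintegral_gaussLift {M : H →ₗ[ℝ] G} (hM : M ∘ₗ LinearMap.adjoint M = LinearMap.id)
    {f : G → ℝ≥0} (hf : Measurable f) :
    ∫⁻ x, (gaussLift M f x : ℝ≥0∞) ∂(stdGaussian H) = ∫⁻ y, (f y : ℝ≥0∞) := by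
  have hMm : Measurable M := (LinearMap.continuous_of_finiteDimensional M).measurable
  rw [lintegral_eq_lintegral_stdGaussian (φ := fun y => (f y : ℝ≥0∞)) (by fun_prop),
    ← map_stdGaussian_of_coisometry M hM, lintegral_map (by fun_prop) hMm]
  simp only [gaussLift, ENNReal.coe_mul, map_smul]

/-- The inverse Brascamp-Lieb inequality under a sign condition on a large subspace. -/
theorem prod_lintegral_rpow_mul_le {ι κ : Type*} [Fintype ι] [Fintype κ]
    {E : ι → Type*} {F : κ → Type*}
    [∀ i, NormedAddCommGroup (E i)] [∀ i, InnerProductSpace ℝ (E i)]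
    [∀ i, FiniteDimensional ℝ (E i)] [∀ i, MeasurableSpace (E i)] [∀ i, BorelSpace (E i)]
    [∀ j, NormedAddCommGroup (F j)] [∀ j, InnerProductSpace ℝ (F j)]
    [∀ j, FiniteDimensional ℝ (F j)] [∀ j, MeasurableSpace (F j)] [∀ j, BorelSpace (F j)]
    {c : ι → ℝ} {d : κ → ℝ} (hd : ∀ j, 0 ≤ d j)
    {Q : H →ₗ[ℝ] H} {U : ∀ i, H →ₗ[ℝ] E i} {V : ∀ j, H →ₗ[ℝ] F j}
    (hU : ∀ i, (U i) ∘ₗ LinearMap.adjoint (U i) = LinearMap.id)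
    (hV : ∀ j, (V j) ∘ₗ LinearMap.adjoint (V j) = LinearMap.id)
    (hquad : ∀ x, ⟪Q x, x⟫ + ∑ i, c i * ‖U i x‖ ^ 2 = ∑ j, d j * ‖V j x‖ ^ 2 + ‖x‖ ^ 2)
    {W : Submodule ℝ H} (hW : ∀ x ∈ W, ⟪Q x, x⟫ ≤ 0)
    (hdim : ∑ i, Module.finrank ℝ (E i) ≤ Module.finrank ℝ W)
    {f : ∀ i, E i → ℝ≥0} {g : ∀ j, F j → ℝ≥0}
    (hf : ∀ i, Measurable (f i)) (hg : ∀ j, Measurable (g j)) :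
    (∏ i, (∫⁻ x, (f i x : ℝ≥0∞)) ^ c i) * ∏ j, (∫⁻ y, (g j y : ℝ≥0∞)) ^ (-(d j)) ≤
      ∫⁻ x : H, ENNReal.ofReal (Real.exp (-(Real.pi * ⟪Q x, x⟫))) *
        ((∏ i, (f i (U i x) : ℝ≥0∞) ^ c i) *
          ∏ j, (g j (V j x) : ℝ≥0∞) ^ (-(d j))) := by
  set h : ι ⊕ κ → H → ℝ≥0 :=
    Sum.elim (fun i => gaussLift (U i) (f i)) (fun j => gaussLift (V j) (g j)) with hh
  set K : ι ⊕ κ → Submodule ℝ H := Sum.elim (fun i => (LinearMap.adjoint (U i)).range)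
    (fun j => (LinearMap.adjoint (V j)).range) with hK
  have key := prod_lintegral_rpow_le (K := K) (α := Sum.elim c fun j => -d j) (h := h) ?_ ?_ ?_
  · simp only [Fintype.prod_sum_type, hh, Sum.elim_inl, Sum.elim_inr, lintegral_gaussLift (hU _)
      (hf _), lintegral_gaussLift (hV _) (hg _)] at key
    refine key.trans_eq ?_
    have hUm : ∀ i, Measurable (U i) := fun i =>
      (LinearMap.continuous_of_finiteDimensional (U i)).measurable
    have hVm : ∀ j, Measurable (V j) := fun j =>
      (LinearMap.continuous_of_finiteDimensional (V j)).measurable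
    have hQm : Measurable Q := (LinearMap.continuous_of_finiteDimensional Q).measurable
    rw [lintegral_eq_lintegral_stdGaussian (by fun_prop)]
    refine lintegral_congr fun x => ?_
    simp only [gaussLift_rpow, Finset.prod_mul_distrib]
    set y := (√(2 * Real.pi))⁻¹ • x
    rw [← ENNReal.ofReal_prod_of_nonneg fun i _ => (Real.exp_pos _).le,
      ← ENNReal.ofReal_prod_of_nonneg fun i _ => (Real.exp_pos _).le, ← Real.exp_sum,
      ← Real.exp_sum, mul_mul_mul_comm, ← ENNReal.ofReal_mul (Real.exp_pos _).le, ← Real.exp_add,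
      mul_right_comm (ENNReal.ofReal (Real.exp (-(Real.pi * ⟪Q y, y⟫))))]
    change _ = ENNReal.ofReal _ * ENNReal.ofReal _ * _
    rw [← ENNReal.ofReal_mul (Real.exp_pos _).le, ← Real.exp_add, mul_comm]
    congr 3
    rw [← Finset.mul_sum, ← Finset.mul_sum]
    simp only [neg_mul, Finset.sum_neg_distrib]
    linear_combination Real.pi * hquad y
  · intro w hw
    choose y hy using fun i => hw (Sum.inl i)
    choose z hz using fun j => hw (Sum.inr j)
    have := sum_mul_norm_sq_sub_le hd hquad hW hdim y z
    simp only [Fintype.sum_sum_type, Sum.elim_inl, Sum.elim_inr, ← hy, ← hz,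
      norm_adjoint_apply_of_coisometry (hU _), norm_adjoint_apply_of_coisometry (hV _), neg_smul,
      neg_mul, Finset.sum_neg_distrib, ← sub_eq_add_neg]
    exact this
  · rintro (i | j)
    · exact measurable_gaussLift _ (hf i)
    · exact measurable_gaussLift _ (hg j)
  · rintro (i | j) x
    · exact gaussLift_starProjection _ _ _
    · exact gaussLift_starProjection _ _ _

end Lebesgue

end GaussianReverseHolder

namespace FRBL

variable {k m : ℕ}
  (E : Fin k → Type*) (F : Fin m → Type*)
  [∀ i, NormedAddCommGroup (E i)] [∀ i, InnerProductSpace ℝ (E i)]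
  [∀ i, FiniteDimensional ℝ (E i)]
  [∀ i, MeasurableSpace (E i)] [∀ i, BorelSpace (E i)]
  [∀ j, NormedAddCommGroup (F j)] [∀ j, InnerProductSpace ℝ (F j)]
  [∀ j, FiniteDimensional ℝ (F j)]
  [∀ j, MeasurableSpace (F j)] [∀ j, BorelSpace (F j)]

/-- **Corollary (geometric inverse Brascamp-Lieb inequality of Barthe-Wolff type).** -/
theorem geometric_inverse_BL
    (c : Fin k → ℝ) (d : Fin m → ℝ)
    (hc : ∀ i, 0 < c i) (hd : ∀ j, 0 < d j)
    (H : Type*) [NormedAddCommGroup H] [InnerProductSpace ℝ H] [FiniteDimensional ℝ H]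
    [MeasurableSpace H] [BorelSpace H]
    (Q : H →ₗ[ℝ] H) (hQ : Q.IsSymmetric)
    (U : ∀ i, H →ₗ[ℝ] E i) (V : ∀ j, H →ₗ[ℝ] F j)
    (hU : ∀ i, (U i) ∘ₗ LinearMap.adjoint (U i) = LinearMap.id)
    (hV : ∀ j, (V j) ∘ₗ LinearMap.adjoint (V j) = LinearMap.id)
    (hsum : Q + (∑ i, c i • (LinearMap.adjoint (U i) ∘ₗ (U i))) =
      (∑ j, d j • (LinearMap.adjoint (V j) ∘ₗ (V j))) + LinearMap.id)
    (hdim : posIndex Q + (∑ i, Module.finrank ℝ (E i)) ≤ Module.finrank ℝ H)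
    (f : ∀ i, E i → ℝ≥0) (g : ∀ j, F j → ℝ≥0)
    (hf : ∀ i, Measurable (f i)) (hg : ∀ j, Measurable (g j)) :
    (∏ i, (∫⁻ x, (f i x : ℝ≥0∞)) ^ c i) * ∏ j, (∫⁻ y, (g j y : ℝ≥0∞)) ^ (-(d j)) ≤
      ∫⁻ x : H, ENNReal.ofReal (Real.exp (-(Real.pi * ⟪Q x, x⟫))) *
        ((∏ i, (f i (U i x) : ℝ≥0∞) ^ c i) *
          ∏ j, (g j (V j x) : ℝ≥0∞) ^ (-(d j))) := by
  have hquad : ∀ x, ⟪Q x, x⟫ + ∑ i, c i * ‖U i x‖ ^ 2 = ∑ j, d j * ‖V j x‖ ^ 2 + ‖x‖ ^ 2 := by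
    intro x
    have h := congrArg (fun T : H →ₗ[ℝ] H => ⟪T x, x⟫) hsum
    simpa only [LinearMap.add_apply, LinearMap.sum_apply, LinearMap.smul_apply,
      LinearMap.comp_apply, LinearMap.id_apply, inner_add_left, sum_inner, real_inner_smul_left,
      LinearMap.adjoint_inner_left, real_inner_self_eq_norm_sq] using h
  obtain ⟨W, W', hW, hW', hrank⟩ := GaussianReverseHolder.exists_pos_nonpos_subspaces hQ
  have hpos : Module.finrank ℝ W ≤ posIndex Q := by
    refine le_csSup ⟨Module.finrank ℝ H, ?_⟩ ⟨W, hW, rfl⟩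
    rintro _ ⟨T, -, rfl⟩
    exact T.finrank_le
  exact GaussianReverseHolder.prod_lintegral_rpow_mul_le (fun j => (hd j).le) hU hV hquad hW'
    (by lia) hf hg

end FRBL
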